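/- Let σ_0, σ_1 be density matrices on ℂ^{d_1} and τ_0, τ_1 density matrices on ℂ^{d_2}, and set H_1 := H(X_1|B_1), H_2 := H(X_2|B_2) and G := H(X_1+X_2|B_1B_2) as in the context. Let p_1, p_2, q_1, q_2 ∈ [0, 1/2] satisfy h₂(p_1) = H_1, h₂(p_2) = H_2, h₂(q_1) = ln 2 − H_1, h₂(q_2) = ln 2 − H_2. Then G is at least the maximum of the following four quantities (all logarithms natural): (a) H_1 − 2 ln cos(½ arccos[(1−2q_1)(e^{H_2}−1)] − ½ arccos[e^{H_2}−1]); (b) H_2 − 2 ln cos(½ arccos[(1−2q_2)(e^{H_1}−1)] − ½ arccos[e^{H_1}−1]); (c) H_2 − 2 ln cos(½ arccos[(1−2p_1)(2e^{−H_2}−1)] − ½ arccos[2e^{−H_2}−1]); (d) H_1 − 2 ln cos(½ arccos[(1−2p_2)(2e^{−H_1}−1)] − ½ arccos[2e^{−H_1}−1]). -/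

import Mathlib

open Matrix ComplexOrder Kronecker

/-- Von Neumann entropy `H(ρ) = Σ_i (−λ_i ln λ_i)` of a Hermitian matrix, via its
eigenvalues (junk value `0` on non-Hermitian matrices). -/
noncomputable def vN {ι : Type} [Fintype ι] [DecidableEq ι] (ρ : Matrix ι ι ℂ) : ℝ :=
  if h : ρ.IsHermitian then ∑ i, Real.negMulLog (h.eigenvalues i) else 0

/-- The binary entropy `h₂(p) = −p ln p − (1−p) ln(1−p)`. -/
noncomputable def h2 (p : ℝ) : ℝ := -(p * Real.log p) - (1 - p) * Real.log (1 - p)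

open Matrix ComplexOrder Kronecker

set_option linter.unusedSectionVars false
set_option linter.unusedSimpArgs false

section basics
variable {ι κ : Type} [Fintype ι] [DecidableEq ι] [Fintype κ] [DecidableEq κ]

/-- real diagonal matrix -/
noncomputable def rdiag (a : ι → ℝ) : Matrix ι ι ℂ := diagonal (fun i => (a i : ℂ))

lemma rdiag_herm (a : ι → ℝ) : (rdiag a)ᴴ = rdiag a := by
  simp [rdiag, diagonal_conjTranspose, Pi.star_def]

lemma conj_rdiag_herm (U : Matrix κ ι ℂ) (a : ι → ℝ) : (U * rdiag a * Uᴴ).IsHermitian := by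
  simp [IsHermitian, conjTranspose_mul, rdiag_herm, Matrix.mul_assoc]

lemma vN_eq_roots {A : Matrix ι ι ℂ} (hA : A.IsHermitian) :
    vN A = (A.charpoly.roots.map (fun z => Real.negMulLog z.re)).sum := by
  rw [vN, dif_pos hA, hA.roots_charpoly_eq_eigenvalues]
  simp [Multiset.map_map]

lemma vN_of_charpoly {A : Matrix ι ι ℂ} {B : Matrix κ κ ℂ} (hA : A.IsHermitian)
    (hB : B.IsHermitian) (h : A.charpoly = B.charpoly) : vN A = vN B := by
  rw [vN_eq_roots hA, vN_eq_roots hB, h]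

lemma vN_conj_diag {U : Matrix ι ι ℂ} (hU : Uᴴ * U = 1) (a : ι → ℝ) :
    vN (U * rdiag a * Uᴴ) = ∑ i, Real.negMulLog (a i) := by
  rw [vN_eq_roots (conj_rdiag_herm U a), Matrix.charpoly_mul_comm, ← Matrix.mul_assoc, hU,
    Matrix.one_mul, rdiag, charpoly_diagonal, Polynomial.roots_prod]
  · simp [Multiset.bind_singleton]
  · rw [Finset.prod_ne_zero_iff]
    intro i _
    exact Polynomial.X_sub_C_ne_zero _

lemma spec_exists {A : Matrix ι ι ℂ} (hA : A.IsHermitian) :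
    ∃ (U : Matrix ι ι ℂ) (a : ι → ℝ), Uᴴ * U = 1 ∧ U * Uᴴ = 1 ∧ A = U * rdiag a * Uᴴ ∧
      (∀ f : ℝ → ℝ, cfc f A = U * rdiag (fun i => f (a i)) * Uᴴ) ∧
      vN A = ∑ i, Real.negMulLog (a i) ∧ a = hA.eigenvalues := by
  refine ⟨hA.eigenvectorUnitary, hA.eigenvalues, ?_, ?_, ?_, ?_, ?_, rfl⟩
  · exact Unitary.coe_star_mul_self _
  · exact Unitary.coe_mul_star_self _
  · conv_lhs => rw [hA.spectral_theorem]
    rfl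
  · intro f
    rw [hA.cfc_eq]
    rfl
  · rw [vN, dif_pos hA]

lemma vN_mul_comm (A : Matrix ι κ ℂ) (B : Matrix κ ι ℂ) (h1 : (A * B).IsHermitian)
    (h2 : (B * A).IsHermitian) : vN (A * B) = vN (B * A) := by
  have key := Matrix.charpoly_mul_comm' A B
  rw [vN_eq_roots h1, vN_eq_roots h2]
  have := congrArg (fun p : Polynomial ℂ => (p.roots.map (fun z => Real.negMulLog z.re)).sum) key
  rw [Polynomial.roots_mul, Polynomial.roots_mul, Polynomial.roots_X_pow,
    Polynomial.roots_X_pow] at this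
  · simpa [Multiset.map_nsmul, Multiset.sum_nsmul] using this
  · exact mul_ne_zero (pow_ne_zero _ Polynomial.X_ne_zero) (charpoly_monic _).ne_zero
  · exact mul_ne_zero (pow_ne_zero _ Polynomial.X_ne_zero) (charpoly_monic _).ne_zero

lemma vN_unitary {A U : Matrix ι ι ℂ} (hA : A.IsHermitian) (hU : U * Uᴴ = 1) :
    vN (Uᴴ * A * U) = vN A := by
  apply vN_of_charpoly _ hA
  · rw [Matrix.charpoly_mul_comm, ← Matrix.mul_assoc, hU, Matrix.one_mul]
  · simp [IsHermitian, conjTranspose_mul, hA.eq, Matrix.mul_assoc]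

lemma vN_reindex (e : ι ≃ κ) {A : Matrix ι ι ℂ} (hA : A.IsHermitian) :
    vN (Matrix.reindex e e A) = vN A := by
  apply vN_of_charpoly _ hA
  · rw [charpoly_reindex]
  · exact hA.submatrix _

lemma vN_smul {A : Matrix ι ι ℂ} (hA : A.IsHermitian) {c : ℝ} :
    vN (c • A) = c * vN A + Real.negMulLog c * A.trace.re := by
  obtain ⟨U, a, hU, hU', hd, -, hv, -⟩ := spec_exists hA
  have h1 : c • A = U * rdiag (fun i => c * a i) * Uᴴ := by
    conv_lhs => rw [hd]
    have : rdiag (fun i => c * a i) = c • rdiag a := by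
      ext i j
      simp [rdiag, diagonal_apply]
      
    rw [this]; simp
  have h2 : A.trace.re = ∑ i, a i := by
    conv_lhs => rw [hd, trace_mul_comm, ← Matrix.mul_assoc, hU, Matrix.one_mul]
    simp [rdiag, trace]
  rw [h1, vN_conj_diag hU, hv, h2, Finset.mul_sum, Finset.mul_sum, ← Finset.sum_add_distrib]
  refine Finset.sum_congr rfl fun i _ => ?_
  rw [Real.negMulLog_mul]; ring

lemma vN_kron {A : Matrix ι ι ℂ} {B : Matrix κ κ ℂ} (hA : A.IsHermitian) (hB : B.IsHermitian) :
    vN (A ⊗ₖ B) = B.trace.re * vN A + A.trace.re * vN B := by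
  obtain ⟨U, a, hU, hU', hd, -, hv, -⟩ := spec_exists hA
  obtain ⟨V, b, hV, hV', hd2, -, hv2, -⟩ := spec_exists hB
  have h1 : A ⊗ₖ B = (U ⊗ₖ V) * rdiag (fun p : ι × κ => a p.1 * b p.2) * (U ⊗ₖ V)ᴴ := by
    conv_lhs => rw [hd, hd2]
    have : rdiag (fun p : ι × κ => a p.1 * b p.2) = rdiag a ⊗ₖ rdiag b := by
      simp only [rdiag, diagonal_kronecker_diagonal]
      congr 1; ext p; simp
    rw [this, conjTranspose_kronecker, mul_kronecker_mul, mul_kronecker_mul]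
  have h2 : A.trace.re = ∑ i, a i := by
    conv_lhs => rw [hd, trace_mul_comm, ← Matrix.mul_assoc, hU, Matrix.one_mul]
    simp [rdiag, trace]
  have h3 : B.trace.re = ∑ i, b i := by
    conv_lhs => rw [hd2, trace_mul_comm, ← Matrix.mul_assoc, hV, Matrix.one_mul]
    simp [rdiag, trace]
  rw [h1, vN_conj_diag, hv, hv2, h2, h3, Finset.sum_mul_sum, Finset.sum_mul_sum,
    Fintype.sum_prod_type]
  · rw [Finset.sum_comm (s := (Finset.univ : Finset κ)), ← Finset.sum_add_distrib]
    refine Finset.sum_congr rfl fun i _ => ?_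
    rw [← Finset.sum_add_distrib]
    refine Finset.sum_congr rfl fun j _ => ?_
    rw [Real.negMulLog_mul]
  · rw [conjTranspose_kronecker, ← mul_kronecker_mul, hU, hV, one_kronecker_one]

lemma vN_fromBlocks {A : Matrix ι ι ℂ} {B : Matrix κ κ ℂ} (hA : A.IsHermitian)
    (hB : B.IsHermitian) : vN (fromBlocks A 0 0 B) = vN A + vN B := by
  rw [vN_eq_roots hA, vN_eq_roots hB, vN_eq_roots, charpoly_fromBlocks_zero₁₂,
    Polynomial.roots_mul, Multiset.map_add, Multiset.sum_add]
  · exact mul_ne_zero (charpoly_monic _).ne_zero (charpoly_monic _).ne_zero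
  · exact IsHermitian.fromBlocks hA (by simp) hB

/-- key duality identity -/
lemma vN_dual (A B : Matrix ι κ ℂ) (S D : Matrix κ κ ℂ) (h1 : Aᴴ * A = S) (h2 : Bᴴ * B = S)
    (h3 : Aᴴ * B = D) (h4 : Bᴴ * A = D) :
    vN ((1 / 2 : ℝ) • (A * Aᴴ + B * Bᴴ)) =
      vN ((1 / 2 : ℝ) • (S + D)) + vN ((1 / 2 : ℝ) • (S - D)) := by
  set P := (1 / 2 : ℝ) • (A + B) with hP
  set Q := (1 / 2 : ℝ) • (A - B) with hQ
  have e1 : Pᴴ * P = (1 / 2 : ℝ) • (S + D) := by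
    simp only [hP, conjTranspose_smul, conjTranspose_add, star_trivial, Matrix.smul_mul,
      Matrix.mul_smul, Matrix.add_mul, Matrix.mul_add, h1, h2, h3, h4]
    module
  have e2 : Qᴴ * Q = (1 / 2 : ℝ) • (S - D) := by
    simp only [hQ, conjTranspose_smul, conjTranspose_sub, star_trivial, Matrix.smul_mul,
      Matrix.mul_smul, Matrix.sub_mul, Matrix.mul_sub, h1, h2, h3, h4]
    module
  have e3 : Pᴴ * Q = 0 := by
    simp only [hP, hQ, conjTranspose_smul, conjTranspose_sub, conjTranspose_add, star_trivial,
      Matrix.smul_mul, Matrix.add_mul,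
      Matrix.mul_smul, Matrix.sub_mul, Matrix.mul_sub, h1, h2, h3, h4]
    module
  have e4 : Qᴴ * P = 0 := by
    have := congrArg conjTranspose e3
    simpa using this
  have e5 : (1 / 2 : ℝ) • (A * Aᴴ + B * Bᴴ) = P * Pᴴ + Q * Qᴴ := by
    simp only [hP, hQ, conjTranspose_smul, conjTranspose_sub, conjTranspose_add, star_trivial,
      Matrix.smul_mul, Matrix.add_mul, Matrix.mul_add,
      Matrix.mul_smul, Matrix.sub_mul, Matrix.mul_sub]
    module
  have e6 : P * Pᴴ + Q * Qᴴ = fromCols P Q * (fromCols P Q)ᴴ := by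
    rw [conjTranspose_fromCols_eq_fromRows_conjTranspose, fromCols_mul_fromRows]
  have e7 : (fromCols P Q)ᴴ * fromCols P Q = fromBlocks (Pᴴ * P) 0 0 (Qᴴ * Q) := by
    rw [conjTranspose_fromCols_eq_fromRows_conjTranspose, fromRows_mul_fromCols, e3, e4]
  rw [e5, e6, vN_mul_comm _ _ (isHermitian_mul_conjTranspose_self _)
    (isHermitian_conjTranspose_mul_self _), e7, vN_fromBlocks
    (isHermitian_conjTranspose_mul_self _) (isHermitian_conjTranspose_mul_self _), e1, e2]

end basics

section scalar

open MeasureTheory Set Filter Topology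

/-- integrand -/
noncomputable def kern (s r u : ℝ) : ℝ := (s - r) ^ 2 / (s + u * r) / (1 + u) ^ 2

lemma kern_integral {s r : ℝ} (hs : 0 < s) (hr : 0 < r) :
    IntegrableOn (kern s r) (Ioi 0) ∧
      ∫ u in Ioi 0, kern s r u = r * Real.log r - r * Real.log s - r + s := by
  have hder : ∀ u ∈ Ici (0 : ℝ), HasDerivAt
      (fun u => r * Real.log ((s + u * r) / (1 + u)) - (s - r) / (1 + u)) (kern s r u) u := by
    intro u hu
    have hu : 0 ≤ u := hu
    have h1 : 0 < 1 + u := by linarith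
    have h2 : 0 < s + u * r := by positivity
    have d1 : HasDerivAt (fun u : ℝ => 1 + u) 1 u := by
      simpa using (hasDerivAt_id u).const_add 1
    have d2 : HasDerivAt (fun u : ℝ => s + u * r) r u := by
      simpa using ((hasDerivAt_id u).mul_const r).const_add s
    have d3 := ((d2.div d1 h1.ne').log (div_pos h2 h1).ne').const_mul r
    have d4 := (hasDerivAt_const u (s - r)).div d1 h1.ne'
    refine (d3.sub d4).congr_deriv ?_
    unfold kern
    simp only [Pi.div_apply]
    field_simp
    ring
  have hpos : ∀ u ∈ Ioi (0 : ℝ), 0 ≤ kern s r u := by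
    intro u hu
    have hu : 0 < u := hu
    unfold kern; positivity
  have hlim : Tendsto (fun u => r * Real.log ((s + u * r) / (1 + u)) - (s - r) / (1 + u)) atTop
      (𝓝 (r * Real.log r)) := by
    have t0 : Tendsto (fun u : ℝ => 1 + u) atTop atTop :=
      tendsto_atTop_add_const_left _ _ tendsto_id
    have t1 : Tendsto (fun u : ℝ => (s - r) / (1 + u)) atTop (𝓝 0) := t0.const_div_atTop _
    have t2 : Tendsto (fun u : ℝ => (s + u * r) / (1 + u)) atTop (𝓝 r) := by
      have : Tendsto (fun u : ℝ => r + (s - r) / (1 + u)) atTop (𝓝 (r + 0)) :=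
        tendsto_const_nhds.add t1
      rw [add_zero] at this
      refine this.congr' ?_
      filter_upwards [eventually_gt_atTop 0] with u hu
      field_simp
      ring
    have := ((t2.log hr.ne').const_mul r).sub t1
    simpa using this
  refine ⟨integrableOn_Ioi_deriv_of_nonneg' hder hpos hlim, ?_⟩
  rw [integral_Ioi_of_hasDerivAt_of_nonneg' hder hpos hlim]
  simp
  ring

lemma scal_log_bound_aux {a b : ℝ} (hb : 0 < b) (hab : b ≤ a) :
    2 * (Real.log a - Real.log b) ≤ a⁻¹ * b⁻¹ * (a ^ 2 - b ^ 2) := by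
  have ha : 0 < a := lt_of_lt_of_le hb hab
  have h := Real.self_le_sinh_iff.2 (sub_nonneg.2 (Real.log_le_log hb hab))
  rw [Real.sinh_eq, neg_sub, Real.exp_sub, Real.exp_sub, Real.exp_log ha, Real.exp_log hb] at h
  have : a⁻¹ * b⁻¹ * (a ^ 2 - b ^ 2) = a / b - b / a := by field_simp
  rw [this]; linarith

lemma scal_log_bound {r s : ℝ} (hr : 0 < r) (hs : 0 < s) :
    (r - s) * (Real.log r - Real.log s) ≤ (Real.sqrt r)⁻¹ * (Real.sqrt s)⁻¹ * (r - s) ^ 2 := by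
  obtain ⟨a, ha, rfl⟩ : ∃ a, 0 < a ∧ r = a ^ 2 :=
    ⟨Real.sqrt r, Real.sqrt_pos.2 hr, (Real.sq_sqrt hr.le).symm⟩
  obtain ⟨b, hb, rfl⟩ : ∃ b, 0 < b ∧ s = b ^ 2 :=
    ⟨Real.sqrt s, Real.sqrt_pos.2 hs, (Real.sq_sqrt hs.le).symm⟩
  rw [Real.sqrt_sq ha.le, Real.sqrt_sq hb.le, Real.log_pow, Real.log_pow]
  push_cast
  rcases le_total b a with h | h
  · have h1 := scal_log_bound_aux hb h
    have h2 : 0 ≤ a ^ 2 - b ^ 2 := by nlinarith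
    nlinarith [mul_le_mul_of_nonneg_left h1 h2]
  · have h1 := scal_log_bound_aux ha h
    have h2 : 0 ≤ b ^ 2 - a ^ 2 := by nlinarith
    nlinarith [mul_le_mul_of_nonneg_left h1 h2]

end scalar

section spectral
variable {ι κ : Type} [Fintype ι] [DecidableEq ι] [Fintype κ] [DecidableEq κ]

lemma trace_mul_conj (Y Z : Matrix ι κ ℂ) :
    (Yᴴ * Z).trace.re = ∑ i, ∑ j, (star (Y i j) * Z i j).re := by
  simp only [trace, Matrix.diag, Matrix.mul_apply, conjTranspose_apply, Complex.re_sum]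
  rw [Finset.sum_comm]

/-- master formula -/
lemma trace_spec (U : Matrix ι ι ℂ) (V : Matrix κ κ ℂ) (f : ι → ℝ) (g : κ → ℝ)
    (X : Matrix ι κ ℂ) :
    ((U * rdiag f * Uᴴ) * X * (V * rdiag g * Vᴴ) * Xᴴ).trace.re =
      ∑ i, ∑ j, f i * g j * Complex.normSq ((Uᴴ * X * V) i j) := by
  set Y := Uᴴ * X * V with hY
  have h1 : ((U * rdiag f * Uᴴ) * X * (V * rdiag g * Vᴴ) * Xᴴ).trace =
      (Yᴴ * (rdiag f * Y * rdiag g)).trace := by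
    have : (U * rdiag f * Uᴴ) * X * (V * rdiag g * Vᴴ) * Xᴴ =
        U * (rdiag f * Y * rdiag g * (Vᴴ * Xᴴ)) := by
      simp only [hY, Matrix.mul_assoc]
    rw [this, trace_mul_comm, trace_mul_comm (Yᴴ)]
    simp only [hY, conjTranspose_mul, conjTranspose_conjTranspose, Matrix.mul_assoc]
  rw [h1, trace_mul_conj]
  refine Finset.sum_congr rfl fun i _ => Finset.sum_congr rfl fun j _ => ?_
  simp only [rdiag, mul_diagonal, diagonal_mul]
  rw [show star (Y i j) * ((f i : ℂ) * Y i j * (g j : ℂ)) =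
    ((f i * g j : ℝ) : ℂ) * (star (Y i j) * Y i j) by push_cast; ring]
  rw [Complex.re_ofReal_mul]
  congr 1
  rw [Complex.star_def, ← Complex.normSq_eq_conj_mul_self, Complex.ofReal_re]

/-- intertwining: matrix elements of the difference -/
lemma diff_elem {U V : Matrix ι ι ℂ} (hU : Uᴴ * U = 1) (hV : Vᴴ * V = 1)
    (a b : ι → ℝ) (i j : ι) :
    (Uᴴ * (U * rdiag a * Uᴴ - V * rdiag b * Vᴴ) * V) i j = ((a i - b j : ℝ) : ℂ) * (Uᴴ * V) i j := by
  have : Uᴴ * (U * rdiag a * Uᴴ - V * rdiag b * Vᴴ) * V =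
      rdiag a * (Uᴴ * V) - (Uᴴ * V) * rdiag b := by
    rw [Matrix.mul_sub, Matrix.sub_mul]
    congr 1
    · rw [Matrix.mul_assoc U, ← Matrix.mul_assoc Uᴴ, hU, Matrix.one_mul, Matrix.mul_assoc]
    · simp only [Matrix.mul_assoc, hV, Matrix.mul_one]
  rw [this]
  simp only [rdiag, Matrix.sub_apply, mul_diagonal, diagonal_mul]
  push_cast; ring

/-- Relative entropy (for positive definite arguments). -/
noncomputable def relD (ρ σ : Matrix ι ι ℂ) : ℝ := -vN ρ - (ρ * cfc Real.log σ).trace.re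

lemma eig_pos {A : Matrix ι ι ℂ} (hA : A.PosDef) (i : ι) : 0 < hA.1.eigenvalues i :=
  hA.eigenvalues_pos i

lemma rdiag_one : rdiag (fun _ : ι => (1 : ℝ)) = 1 := by
  simp [rdiag]

lemma trace_cfc_mul {A B U V : Matrix ι ι ℂ} {f g : ι → ℝ}
    (hA : A = U * rdiag f * Uᴴ) (hB : B = V * rdiag g * Vᴴ) :
    (A * B).trace.re = ∑ i, ∑ j, f i * g j * Complex.normSq ((Uᴴ * V) i j) := by
  have := trace_spec U V f g 1
  rw [← hA, ← hB] at this
  simpa using this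

/-- double sum data for a pair of positive definite matrices -/
lemma relD_eq {ρ σ U V : Matrix ι ι ℂ} {r s : ι → ℝ}
    (hU : Uᴴ * U = 1) (hU' : U * Uᴴ = 1) (hV : Vᴴ * V = 1) (hV' : V * Vᴴ = 1)
    (hσ : ∀ f : ℝ → ℝ, cfc f σ = U * rdiag (fun i => f (s i)) * Uᴴ)
    (hρ : ρ = V * rdiag r * Vᴴ) :
    relD ρ σ = ∑ i, ∑ j, (r j * Real.log (r j) - r j * Real.log (s i)) *
      Complex.normSq ((Uᴴ * V) i j) := by
  have h1 : (ρ * cfc Real.log σ).trace.re =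
      ∑ i, ∑ j, Real.log (s i) * r j * Complex.normSq ((Uᴴ * V) i j) := by
    rw [trace_mul_comm]
    exact trace_cfc_mul (hσ _) hρ
  have h2 : -vN ρ = ∑ i, ∑ j, 1 * (r j * Real.log (r j)) * Complex.normSq ((Uᴴ * V) i j) := by
    have h0 : (1 : Matrix ι ι ℂ) = U * rdiag (fun _ => (1 : ℝ)) * Uᴴ := by
      rw [rdiag_one, Matrix.mul_one, hU']
    rw [← trace_cfc_mul h0 rfl, Matrix.one_mul, trace_mul_comm, ← Matrix.mul_assoc, hV,
      Matrix.one_mul, hρ, vN_conj_diag hV]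
    simp [rdiag, trace, Real.negMulLog]
  rw [relD, h1, h2, ← Finset.sum_sub_distrib]
  refine Finset.sum_congr rfl fun i _ => ?_
  rw [← Finset.sum_sub_distrib]
  refine Finset.sum_congr rfl fun j _ => ?_
  ring

lemma normSq_sum {U V : Matrix ι ι ℂ} {r s : ι → ℝ} {ρ σ : Matrix ι ι ℂ}
    (hU : Uᴴ * U = 1) (hU' : U * Uᴴ = 1) (hV : Vᴴ * V = 1) (hV' : V * Vᴴ = 1)
    (hσ : σ = U * rdiag s * Uᴴ) (hρ : ρ = V * rdiag r * Vᴴ) :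
    ∑ i, ∑ j, (r j - s i) * Complex.normSq ((Uᴴ * V) i j) = ρ.trace.re - σ.trace.re := by
  have h0 : (1 : Matrix ι ι ℂ) = U * rdiag (fun _ => (1 : ℝ)) * Uᴴ := by
    rw [rdiag_one, Matrix.mul_one, hU']
  have h0' : (1 : Matrix ι ι ℂ) = V * rdiag (fun _ => (1 : ℝ)) * Vᴴ := by
    rw [rdiag_one, Matrix.mul_one, hV']
  have h1 := trace_cfc_mul h0 hρ
  have h2 := trace_cfc_mul hσ h0'
  rw [Matrix.one_mul] at h1
  rw [Matrix.mul_one] at h2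
  rw [h1, h2, ← Finset.sum_sub_distrib]
  refine Finset.sum_congr rfl fun i _ => ?_
  rw [← Finset.sum_sub_distrib]
  refine Finset.sum_congr rfl fun j _ => ?_
  ring

/-- Klein inequality -/
lemma klein {ρ σ : Matrix ι ι ℂ} (hρ : ρ.PosDef) (hσ : σ.PosDef) :
    ρ.trace.re - σ.trace.re ≤ relD ρ σ := by
  obtain ⟨U, s, hU, hU', hd, hf, -, hs⟩ := spec_exists hσ.1
  obtain ⟨V, r, hV, hV', hd2, -, -, hr⟩ := spec_exists hρ.1
  rw [relD_eq hU hU' hV hV' hf hd2, ← normSq_sum hU hU' hV hV' hd hd2]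
  refine Finset.sum_le_sum fun i _ => Finset.sum_le_sum fun j _ => ?_
  refine mul_le_mul_of_nonneg_right ?_ (Complex.normSq_nonneg _)
  have h1 : 0 < s i := by rw [hs]; exact eig_pos hσ i
  have h2 : 0 < r j := by rw [hr]; exact eig_pos hρ j
  have h3 := Real.log_le_sub_one_of_pos (div_pos h1 h2)
  rw [Real.log_div h1.ne' h2.ne'] at h3
  have h4 := mul_le_mul_of_nonneg_left h3 h2.le
  have h5 : r j * (s i / r j - 1) = s i - r j := by field_simp
  nlinarith

/-- the symmetrised relative entropy bound -/
lemma symm_bound {A B Δ : Matrix ι ι ℂ} (hA : A.PosDef) (hB : B.PosDef) (hΔ : Δ = B - A) :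
    (Δ * (cfc Real.log B - cfc Real.log A)).trace.re ≤
      (cfc (fun x => (Real.sqrt x)⁻¹) B * Δ * cfc (fun x => (Real.sqrt x)⁻¹) A * Δ).trace.re := by
  obtain ⟨U, s, hU, hU', hd, hf, hvA, hs⟩ := spec_exists hA.1
  obtain ⟨V, r, hV, hV', hd2, hf2, hvB, hr⟩ := spec_exists hB.1
  have e1 : (Δ * (cfc Real.log B - cfc Real.log A)).trace.re = relD B A + relD A B := by
    have hA' : A * cfc Real.log A = U * rdiag (fun i => s i * Real.log (s i)) * Uᴴ := by
      rw [hf]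
      nth_rw 1 [hd]
      have : rdiag (fun i => s i * Real.log (s i)) = rdiag s * rdiag (fun i => Real.log (s i)) := by
        simp [rdiag]
      rw [this, Matrix.mul_assoc (U * rdiag s), ← Matrix.mul_assoc Uᴴ, ← Matrix.mul_assoc Uᴴ, hU,
        Matrix.one_mul]
      simp only [Matrix.mul_assoc]
    have hB' : B * cfc Real.log B = V * rdiag (fun i => r i * Real.log (r i)) * Vᴴ := by
      rw [hf2]
      nth_rw 1 [hd2]
      have : rdiag (fun i => r i * Real.log (r i)) = rdiag r * rdiag (fun i => Real.log (r i)) := by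
        simp [rdiag]
      rw [this, Matrix.mul_assoc (V * rdiag r), ← Matrix.mul_assoc Vᴴ, ← Matrix.mul_assoc Vᴴ, hV,
        Matrix.one_mul]
      simp only [Matrix.mul_assoc]
    have tA : (A * cfc Real.log A).trace.re = -vN A := by
      rw [hA', trace_mul_comm, ← Matrix.mul_assoc, hU, Matrix.one_mul, hvA]
      simp [rdiag, trace, Real.negMulLog]
    have tB : (B * cfc Real.log B).trace.re = -vN B := by
      rw [hB', trace_mul_comm, ← Matrix.mul_assoc, hV, Matrix.one_mul, hvB]
      simp [rdiag, trace, Real.negMulLog]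
    rw [hΔ, Matrix.sub_mul, Matrix.mul_sub, Matrix.mul_sub, trace_sub, trace_sub, trace_sub]
    simp only [Complex.sub_re, tA, tB, relD]
    ring
  have hΔh : Δᴴ = Δ := by rw [hΔ, conjTranspose_sub, hA.1.eq, hB.1.eq]
  have e2 : relD B A + relD A B = ∑ i, ∑ j, (r i - s j) * (Real.log (r i) - Real.log (s j)) *
      Complex.normSq ((Vᴴ * U) i j) := by
    rw [relD_eq hU hU' hV hV' hf hd2, relD_eq hV hV' hU hU' hf2 hd, Finset.sum_comm,
      ← Finset.sum_add_distrib]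
    refine Finset.sum_congr rfl fun i _ => ?_
    rw [← Finset.sum_add_distrib]
    refine Finset.sum_congr rfl fun j _ => ?_
    have : Complex.normSq ((Uᴴ * V) j i) = Complex.normSq ((Vᴴ * U) i j) := by
      have h : (Uᴴ * V) = (Vᴴ * U)ᴴ := by simp
      rw [h, conjTranspose_apply]
      simp
    rw [this]; ring
  have e3 : (cfc (fun x => (Real.sqrt x)⁻¹) B * Δ * cfc (fun x => (Real.sqrt x)⁻¹) A * Δ).trace.re =
      ∑ i, ∑ j, (Real.sqrt (r i))⁻¹ * (Real.sqrt (s j))⁻¹ *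
        ((r i - s j) ^ 2 * Complex.normSq ((Vᴴ * U) i j)) := by
    have := trace_spec V U (fun i => (Real.sqrt (r i))⁻¹) (fun i => (Real.sqrt (s i))⁻¹) Δ
    rw [← hf2 (fun x => (Real.sqrt x)⁻¹), ← hf (fun x => (Real.sqrt x)⁻¹), hΔh] at this
    rw [this]
    refine Finset.sum_congr rfl fun i _ => Finset.sum_congr rfl fun j _ => ?_
    congr 1
    rw [hΔ]
    nth_rw 1 [hd, hd2]
    rw [diff_elem hV hU, Complex.normSq_mul, Complex.normSq_ofReal]
    ring
  rw [e1, e2, e3]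
  refine Finset.sum_le_sum fun i _ => Finset.sum_le_sum fun j _ => ?_
  rw [← mul_assoc]
  refine mul_le_mul_of_nonneg_right ?_ (Complex.normSq_nonneg _)
  have h1 : 0 < s j := by rw [hs]; exact eig_pos hA j
  have h2 : 0 < r i := by rw [hr]; exact eig_pos hB i
  exact scal_log_bound h2 h1

end spectral

section dpi
open MeasureTheory Set Filter Topology
variable {ι κ : Type} [Fintype ι] [DecidableEq ι] [Fintype κ] [DecidableEq κ]

/-- the variational functional -/
noncomputable def varF (ρ σ : Matrix ι ι ℂ) (u : ℝ) (X : Matrix ι ι ℂ) : ℝ :=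
  2 * ((σ - ρ) * Xᴴ).trace.re - (σ * (X * Xᴴ)).trace.re - u * (ρ * (Xᴴ * X)).trace.re

lemma quad_bound (y z : ℂ) {a : ℝ} (ha : 0 < a) :
    2 * (star y * z).re - a * Complex.normSq y ≤ Complex.normSq z / a := by
  rw [le_div_iff₀ ha]
  simp only [Complex.normSq_apply, Complex.star_def, Complex.mul_re, Complex.conj_re,
    Complex.conj_im]
  nlinarith [sq_nonneg (a * y.re - z.re), sq_nonneg (a * y.im - z.im)]

lemma quad_eq (z : ℂ) {a : ℝ} (ha : 0 < a) :
    2 * (star (((a⁻¹ : ℝ) : ℂ) * z) * z).re - a * Complex.normSq (((a⁻¹ : ℝ) : ℂ) * z) =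
      Complex.normSq z / a := by
  rw [Complex.normSq_mul, Complex.normSq_ofReal, star_mul', mul_assoc]
  rw [show star z * z = ((Complex.normSq z : ℝ) : ℂ) from
    (Complex.normSq_eq_conj_mul_self (z := z)).symm]
  rw [Complex.star_def, Complex.conj_ofReal, ← Complex.ofReal_mul, Complex.ofReal_re]
  field_simp
  ring

lemma varF_eq {ρ σ U V : Matrix ι ι ℂ} {r s : ι → ℝ}
    (hU : Uᴴ * U = 1) (hU' : U * Uᴴ = 1) (hV : Vᴴ * V = 1) (hV' : V * Vᴴ = 1)
    (hσ : σ = U * rdiag s * Uᴴ) (hρ : ρ = V * rdiag r * Vᴴ) (u : ℝ) (X : Matrix ι ι ℂ) :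
    varF ρ σ u X = ∑ i, ∑ j, (2 * (star ((Uᴴ * X * V) i j) * (Uᴴ * (σ - ρ) * V) i j).re -
      (s i + u * r j) * Complex.normSq ((Uᴴ * X * V) i j)) := by
  have h0 : (1 : Matrix ι ι ℂ) = U * rdiag (fun _ => (1 : ℝ)) * Uᴴ := by
    rw [rdiag_one, Matrix.mul_one, hU']
  have h0' : (1 : Matrix ι ι ℂ) = V * rdiag (fun _ => (1 : ℝ)) * Vᴴ := by
    rw [rdiag_one, Matrix.mul_one, hV']
  have t1 : ((σ - ρ) * Xᴴ).trace.re =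
      ∑ i, ∑ j, (star ((Uᴴ * X * V) i j) * (Uᴴ * (σ - ρ) * V) i j).re := by
    rw [← trace_mul_conj]
    congr 1
    have : (Uᴴ * X * V)ᴴ * (Uᴴ * (σ - ρ) * V) = Vᴴ * (Xᴴ * (U * Uᴴ) * (σ - ρ) * V) := by
      simp only [conjTranspose_mul, conjTranspose_conjTranspose, Matrix.mul_assoc]
    rw [this, hU', Matrix.mul_one, trace_mul_comm Vᴴ, Matrix.mul_assoc _ V, hV', Matrix.mul_one,
      trace_mul_comm]
  have t2 := trace_spec U V s (fun _ => 1) X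
  rw [← hσ, ← h0', Matrix.mul_one, Matrix.mul_assoc] at t2
  have t3 := trace_spec U V (fun _ => 1) r X
  rw [← hρ, ← h0, Matrix.one_mul, trace_mul_comm, ← Matrix.mul_assoc, trace_mul_comm] at t3
  rw [varF, t1, t2, t3, Finset.mul_sum, Finset.mul_sum, ← Finset.sum_sub_distrib,
    ← Finset.sum_sub_distrib]
  refine Finset.sum_congr rfl fun i _ => ?_
  rw [Finset.mul_sum, Finset.mul_sum, ← Finset.sum_sub_distrib,
    ← Finset.sum_sub_distrib]
  refine Finset.sum_congr rfl fun j _ => ?_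
  ring

lemma relD_var {ρ σ : Matrix ι ι ℂ} (hρ : ρ.PosDef) (hσ : σ.PosDef) :
    ∃ q : ℝ → ℝ, IntegrableOn (fun u => q u / (1 + u) ^ 2) (Ioi 0) ∧
      ∫ u in Ioi 0, q u / (1 + u) ^ 2 = relD ρ σ - ρ.trace.re + σ.trace.re ∧
      ∀ u, 0 < u → (∀ X, varF ρ σ u X ≤ q u) ∧ ∃ X, varF ρ σ u X = q u := by
  obtain ⟨U, s, hU, hU', hd, hf, -, hs⟩ := spec_exists hσ.1
  obtain ⟨V, r, hV, hV', hd2, -, -, hr⟩ := spec_exists hρ.1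
  have hs0 : ∀ i, 0 < s i := fun i => by rw [hs]; exact eig_pos hσ i
  have hr0 : ∀ i, 0 < r i := fun i => by rw [hr]; exact eig_pos hρ i
  have hZ : ∀ i j, Complex.normSq ((Uᴴ * (σ - ρ) * V) i j) =
      (s i - r j) ^ 2 * Complex.normSq ((Uᴴ * V) i j) := by
    intro i j
    nth_rw 1 [hd, hd2]
    rw [diff_elem hU hV, Complex.normSq_mul, Complex.normSq_ofReal]
    ring
  set q : ℝ → ℝ := fun u => ∑ i, ∑ j, Complex.normSq ((Uᴴ * (σ - ρ) * V) i j) / (s i + u * r j)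
    with hq
  have hqk : (fun u => q u / (1 + u) ^ 2) =
      fun u => ∑ i, ∑ j, Complex.normSq ((Uᴴ * V) i j) * kern (s i) (r j) u := by
    funext u
    simp only [hq, Finset.sum_div, hZ, kern]
    refine Finset.sum_congr rfl fun i _ => Finset.sum_congr rfl fun j _ => ?_
    ring
  have hintg : ∀ i j, IntegrableOn (fun u => Complex.normSq ((Uᴴ * V) i j) * kern (s i) (r j) u)
      (Ioi 0) := fun i j => (kern_integral (hs0 i) (hr0 j)).1.const_mul _
  refine ⟨q, ?_, ?_, ?_⟩
  · rw [hqk]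
    exact integrable_finsetSum _ fun i _ => integrable_finsetSum _ fun j _ => hintg i j
  · rw [hqk, integral_finsetSum _ fun i _ => integrable_finsetSum _ fun j _ => hintg i j,
      relD_eq hU hU' hV hV' hf hd2, sub_add, ← normSq_sum hU hU' hV hV' hd hd2,
      ← Finset.sum_sub_distrib]
    refine Finset.sum_congr rfl fun i _ => ?_
    rw [integral_finsetSum _ fun j _ => hintg i j, ← Finset.sum_sub_distrib]
    refine Finset.sum_congr rfl fun j _ => ?_
    rw [integral_const_mul, (kern_integral (hs0 i) (hr0 j)).2]
    ring
  · intro u hu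
    have ha : ∀ i j, 0 < s i + u * r j := fun i j =>
      add_pos (hs0 i) (mul_pos hu (hr0 j))
    refine ⟨fun X => ?_, ?_⟩
    · rw [varF_eq hU hU' hV hV' hd hd2]
      exact Finset.sum_le_sum fun i _ => Finset.sum_le_sum fun j _ => quad_bound _ _ (ha i j)
    · let Y : Matrix ι ι ℂ := Matrix.of fun i j =>
        (((s i + u * r j)⁻¹ : ℝ) : ℂ) * (Uᴴ * (σ - ρ) * V) i j
      refine ⟨U * Y * Vᴴ, ?_⟩
      rw [varF_eq hU hU' hV hV' hd hd2]
      have : Uᴴ * (U * Y * Vᴴ) * V = Y := by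
        rw [Matrix.mul_assoc U, ← Matrix.mul_assoc Uᴴ, hU, Matrix.one_mul, Matrix.mul_assoc, hV,
          Matrix.mul_one]
      rw [this]
      exact Finset.sum_congr rfl fun i _ => Finset.sum_congr rfl fun j _ => quad_eq _ (ha i j)

/-- diagonal block -/
def blk (b : ι) (M : Matrix (ι × κ) (ι × κ) ℂ) : Matrix κ κ ℂ :=
  M.submatrix (fun k => (b, k)) (fun k => (b, k))

/-- block diagonal matrix -/
def bdm (X : ι → Matrix κ κ ℂ) : Matrix (ι × κ) (ι × κ) ℂ :=
  (blockDiagonal X).submatrix Prod.swap Prod.swap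

lemma bdm_mul (X Y : ι → Matrix κ κ ℂ) : bdm X * bdm Y = bdm (fun b => X b * Y b) := by
  unfold bdm
  rw [blockDiagonal_mul]
  exact submatrix_mul_equiv _ _ _ (Equiv.prodComm ι κ) _

lemma bdm_conj (X : ι → Matrix κ κ ℂ) : (bdm X)ᴴ = bdm (fun b => (X b)ᴴ) := by
  unfold bdm
  rw [conjTranspose_submatrix, blockDiagonal_conjTranspose]

lemma trace_mul_bdm (M : Matrix (ι × κ) (ι × κ) ℂ) (X : ι → Matrix κ κ ℂ) :
    (M * bdm X).trace = ∑ b, (blk b M * X b).trace := by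
  simp only [trace, Matrix.diag, Matrix.mul_apply, bdm, blk, submatrix_apply, blockDiagonal_apply,
    Fintype.sum_prod_type, Prod.swap]
  simp

lemma varF_bdm (ρ σ : Matrix (ι × κ) (ι × κ) ℂ) (u : ℝ) (X : ι → Matrix κ κ ℂ) :
    varF ρ σ u (bdm X) = ∑ b, varF (blk b ρ) (blk b σ) u (X b) := by
  have hb : ∀ b, blk b (σ - ρ) = blk b σ - blk b ρ := fun b => rfl
  simp only [varF, bdm_conj, bdm_mul, trace_mul_bdm, hb, Complex.re_sum, Finset.mul_sum,
    ← Finset.sum_sub_distrib]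

lemma blk_posDef {M : Matrix (ι × κ) (ι × κ) ℂ} (hM : M.PosDef) (b : ι) : (blk b M).PosDef :=
  hM.submatrix (fun x y h => by simpa using h)

/-- Data processing under pinching. -/
lemma pinch_relD {ρ σ : Matrix (ι × κ) (ι × κ) ℂ} (hρ : ρ.PosDef) (hσ : σ.PosDef) :
    ∑ b, (relD (blk b ρ) (blk b σ) - (blk b ρ).trace.re + (blk b σ).trace.re) ≤
      relD ρ σ - ρ.trace.re + σ.trace.re := by
  obtain ⟨q, hq1, hq2, hq3⟩ := relD_var hρ hσ
  choose Q hQ1 hQ2 hQ3 using fun b => relD_var (blk_posDef hρ b) (blk_posDef hσ b)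
  rw [← hq2]
  simp only [← hQ2]
  rw [← integral_finsetSum _ fun b _ => hQ1 b]
  refine setIntegral_mono_on (integrable_finsetSum _ fun b _ => hQ1 b) hq1 measurableSet_Ioi ?_
  intro u hu
  rw [← Finset.sum_div]
  refine div_le_div_of_nonneg_right ?_ (by positivity)
  choose X hX using fun b => (hQ3 b u hu).2
  have := (hq3 u hu).1 (bdm X)
  rw [varF_bdm] at this
  simpa only [hX] using this

lemma trace_blk (M : Matrix (ι × κ) (ι × κ) ℂ) : ∑ b, (blk b M).trace = M.trace := by
  simp only [trace, Matrix.diag, blk, submatrix_apply, Fintype.sum_prod_type]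

lemma trace_mul_log {A : Matrix ι ι ℂ} (hA : A.IsHermitian) :
    (A * cfc Real.log A).trace.re = -vN A := by
  obtain ⟨U, s, hU, hU', hd, hf, hvA, hs⟩ := spec_exists hA
  have hA' : A * cfc Real.log A = U * rdiag (fun i => s i * Real.log (s i)) * Uᴴ := by
    rw [hf]
    nth_rw 1 [hd]
    have : rdiag (fun i => s i * Real.log (s i)) = rdiag s * rdiag (fun i => Real.log (s i)) := by
      simp [rdiag]
    rw [this, Matrix.mul_assoc (U * rdiag s), ← Matrix.mul_assoc Uᴴ, ← Matrix.mul_assoc Uᴴ, hU,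
      Matrix.one_mul]
    simp only [Matrix.mul_assoc]
  rw [hA', trace_mul_comm, ← Matrix.mul_assoc, hU, Matrix.one_mul, hvA]
  simp [rdiag, trace, Real.negMulLog]

lemma relD_sum {ρ₀ ρ₁ ω : Matrix ι ι ℂ} (hω : ω.IsHermitian) (h : ρ₀ + ρ₁ = (2 : ℝ) • ω) :
    relD ρ₀ ω + relD ρ₁ ω = 2 * vN ω - vN ρ₀ - vN ρ₁ := by
  have h1 := trace_mul_log hω
  have h2 : (ρ₀ * cfc Real.log ω).trace.re + (ρ₁ * cfc Real.log ω).trace.re =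
      2 * (ω * cfc Real.log ω).trace.re := by
    rw [← Complex.add_re, ← trace_add, ← Matrix.add_mul, h, smul_mul_assoc, trace_smul]
    simp
  rw [h1] at h2
  unfold relD
  linarith

/-- Holevo quantity is monotone under pinching. -/
lemma pinch_holevo {ρ₀ ρ₁ ω : Matrix (ι × κ) (ι × κ) ℂ} (h0 : ρ₀.PosDef) (h1 : ρ₁.PosDef)
    (hω : ω.PosDef) (h : ρ₀ + ρ₁ = (2 : ℝ) • ω) :
    ∑ b, (2 * vN (blk b ω) - vN (blk b ρ₀) - vN (blk b ρ₁)) ≤ 2 * vN ω - vN ρ₀ - vN ρ₁ := by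
  have e0 := pinch_relD h0 hω
  have e1 := pinch_relD h1 hω
  rw [Finset.sum_add_distrib, Finset.sum_sub_distrib, ← Complex.re_sum, ← Complex.re_sum,
    trace_blk, trace_blk] at e0 e1
  rw [← relD_sum hω.1 h]
  have : ∀ b, 2 * vN (blk b ω) - vN (blk b ρ₀) - vN (blk b ρ₁) =
      relD (blk b ρ₀) (blk b ω) + relD (blk b ρ₁) (blk b ω) := by
    intro b
    rw [relD_sum (blk_posDef hω b).1]
    change blk b (ρ₀ + ρ₁) = _
    rw [h]; rfl
  simp only [this, Finset.sum_add_distrib]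
  linarith

end dpi

section cont
open Set Filter Topology
variable {ι κ : Type} [Fintype ι] [DecidableEq ι] [Fintype κ] [DecidableEq κ]

open scoped Matrix.Norms.L2Operator in
lemma cfc_contOn {f : ℝ → ℝ} {s : Set ℝ} (hs : IsOpen s) (hf : ContinuousOn f s)
    {a : ℝ → Matrix ι ι ℂ} {t : Set ℝ} (ha : ContinuousOn a t)
    (hh : ∀ x ∈ t, (a x).IsHermitian) (hsp : ∀ x ∈ t, spectrum ℝ (a x) ⊆ s) :
    ContinuousOn (fun x => cfc f (a x)) t := by
  have := ContinuousOn.cfc_of_mem_nhdsSet (𝕜 := ℝ) (p := IsSelfAdjoint) (s := s) f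
    (a := a) (t := t) (hs.mem_nhdsSet.2 (by simpa using hsp)) ha hh hf
  exact this

lemma vN_eq_trace {A : Matrix ι ι ℂ} (hA : A.IsHermitian) :
    vN A = (cfc Real.negMulLog A).trace.re := by
  obtain ⟨U, s, hU, hU', hd, hf, hvA, hs⟩ := spec_exists hA
  rw [hf, trace_mul_comm, ← Matrix.mul_assoc, hU, Matrix.one_mul, hvA]
  simp [rdiag, trace]

lemma trace_re_cont : Continuous (fun A : Matrix ι ι ℂ => A.trace.re) := by fun_prop

lemma vN_contOn {a : ℝ → Matrix ι ι ℂ} {t : Set ℝ} (ha : ContinuousOn a t)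
    (hh : ∀ x ∈ t, (a x).IsHermitian) : ContinuousOn (fun x => vN (a x)) t := by
  have h := cfc_contOn isOpen_univ Real.continuous_negMulLog.continuousOn ha hh
    (fun _ _ => subset_univ _)
  refine (trace_re_cont.comp_continuousOn h).congr fun x hx => ?_
  rw [vN_eq_trace (hh x hx)]; rfl

lemma spec_pos {A : Matrix ι ι ℂ} (hA : A.PosDef) : spectrum ℝ A ⊆ Ioi 0 := by
  rw [hA.1.spectrum_real_eq_range_eigenvalues]
  rintro _ ⟨i, rfl⟩
  exact eig_pos hA i

end cont

section bpart
open Set Filter Topology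
variable {ι κ : Type} [Fintype ι] [DecidableEq ι] [Fintype κ] [DecidableEq κ]

/-- `ln 2 - h₂((1-c)/2)` -/
noncomputable def phi (c : ℝ) : ℝ :=
  (1 / 2) * ((1 + c) * Real.log (1 + c) + (1 - c) * Real.log (1 - c))

/-- derivative of `phi` -/
noncomputable def phi' (c : ℝ) : ℝ := (1 / 2) * (Real.log (1 + c) - Real.log (1 - c))

lemma phi_zero : phi 0 = 0 := by simp [phi]
lemma phi'_zero : phi' 0 = 0 := by simp [phi']
lemma phi_neg (c : ℝ) : phi (-c) = phi c := by
  simp only [phi, sub_neg_eq_add, ← sub_eq_add_neg]; ring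

lemma hasDerivAt_phi' {c : ℝ} (h1 : -1 < c) (h2 : c < 1) :
    HasDerivAt phi' ((1 / 2) * ((1 + c)⁻¹ + (1 - c)⁻¹)) c := by
  have a1 : HasDerivAt (fun x : ℝ => 1 + x) 1 c := (hasDerivAt_id c).const_add 1
  have a2 : HasDerivAt (fun x : ℝ => 1 - x) (-1) c := (hasDerivAt_id c).const_sub 1
  have := ((a1.log (by linarith)).sub (a2.log (by linarith))).const_mul (1 / 2)
  refine this.congr_deriv ?_
  ring

lemma hasDerivAt_phi {c : ℝ} (h1 : -1 < c) (h2 : c < 1) : HasDerivAt phi (phi' c) c := by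
  have a1 : HasDerivAt (fun x : ℝ => 1 + x) 1 c := (hasDerivAt_id c).const_add 1
  have a2 : HasDerivAt (fun x : ℝ => 1 - x) (-1) c := (hasDerivAt_id c).const_sub 1
  have n1 : (1 + c) ≠ 0 := by linarith
  have n2 : (1 - c) ≠ 0 := by linarith
  have := ((a1.mul (a1.log n1)).add (a2.mul (a2.log n2))).const_mul (1 / 2)
  refine this.congr_deriv ?_
  unfold phi'
  field_simp
  ring

lemma phi_cont : Continuous phi := by
  have : phi = fun c => (1 / 2) * (-(Real.negMulLog (1 + c)) - Real.negMulLog (1 - c)) := by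
    funext c; simp only [phi, Real.negMulLog]; ring
  rw [this]
  have h := Real.continuous_negMulLog
  fun_prop

variable {M δ U : Matrix ι ι ℂ} {e : ι → ℝ}

lemma path_posDef (hp : (M + δ).PosDef) (hm : (M - δ).PosDef) {c : ℝ} (h1 : -1 < c) (h2 : c < 1) :
    (M + c • δ).PosDef := by
  have : M + c • δ = ((1 + c) / 2) • (M + δ) + ((1 - c) / 2) • (M - δ) := by module
  rw [this]
  exact (hp.smul (by linarith)).add (hm.smul (by linarith))

lemma invsqrt_mul {A : Matrix ι ι ℂ} (hA : A.PosDef) :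
    cfc (fun x => (Real.sqrt x)⁻¹) A * A * cfc (fun x => (Real.sqrt x)⁻¹) A = 1 := by
  obtain ⟨U, s, hU, hU', hd, hf, hvA, hs⟩ := spec_exists hA.1
  have hs0 : ∀ i, 0 < s i := fun i => by rw [hs]; exact eig_pos hA i
  have h : ∀ X Y : Matrix ι ι ℂ, U * X * Uᴴ * (U * Y * Uᴴ) = U * (X * Y) * Uᴴ := by
    intro X Y
    calc U * X * Uᴴ * (U * Y * Uᴴ) = U * X * (Uᴴ * U) * (Y * Uᴴ) := by
          simp only [Matrix.mul_assoc]
      _ = _ := by rw [hU, Matrix.mul_one]; simp only [Matrix.mul_assoc]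
  rw [hf]
  nth_rw 1 [hd]
  rw [h, h]
  have : rdiag (fun i => (√(s i))⁻¹) * rdiag s * rdiag (fun i => (√(s i))⁻¹) = 1 := by
    simp only [rdiag, diagonal_mul_diagonal]
    rw [← diagonal_one]
    congr 1
    funext i
    rw [← Complex.ofReal_mul, ← Complex.ofReal_mul, ← Complex.ofReal_one]
    congr 1
    have h1 := Real.mul_self_sqrt (hs0 i).le
    have h2 := Real.sqrt_pos.2 (hs0 i)
    field_simp
    nlinarith
  rw [this, Matrix.mul_one, hU']

lemma cfc_herm (f : ℝ → ℝ) (A : Matrix ι ι ℂ) : (cfc f A)ᴴ = cfc f A :=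
  (cfc_predicate f A : IsSelfAdjoint _)

lemma conj_diag_nonneg {P : Matrix ι ι ℂ} (hP : P.PosSemidef) (W : Matrix ι ι ℂ) (i : ι) :
    0 ≤ ((W * P * Wᴴ) i i).re := by
  have h := (hP.mul_mul_conjTranspose_same W).diag_nonneg (i := i)
  exact (Complex.le_def.1 h).1

lemma second_deriv_bound (hp : (M + δ).PosDef) (hm : (M - δ).PosDef)
    (hU : Uᴴ * U = 1) (hδ : δ = U * rdiag e * Uᴴ) (he : ∑ i, e i = 0)
    {c : ℝ} (h1 : -1 < c) (h2 : c < 1) :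
    (cfc (fun x => (Real.sqrt x)⁻¹) (M + c • δ) * δ *
      cfc (fun x => (Real.sqrt x)⁻¹) (M + c • δ) * δ).trace.re ≤
      (∑ i, |e i|) * ((1 / 2) * ((1 + c)⁻¹ + (1 - c)⁻¹)) := by
  have hA := path_posDef hp hm h1 h2
  have hS := invsqrt_mul hA
  have hSh := cfc_herm (fun x => (Real.sqrt x)⁻¹) (M + c • δ)
  set A := M + c • δ with hAdef
  set S := cfc (fun x => (Real.sqrt x)⁻¹) A with hSdef
  set W := Uᴴ * S with hW
  have hWh : Wᴴ = S * U := by rw [hW, conjTranspose_mul, conjTranspose_conjTranspose, hSh]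
  set y : ι → ℝ := fun i => ((W * δ * Wᴴ) i i).re with hy
  have hWA : W * A * Wᴴ = 1 := by
    rw [hWh, hW]
    calc Uᴴ * S * A * (S * U) = Uᴴ * (S * A * S) * U := by simp only [Matrix.mul_assoc]
      _ = 1 := by rw [hS, Matrix.mul_one, hU]
  have htr : (S * δ * S * δ).trace.re = ∑ i, e i * y i := by
    nth_rw 2 [hδ]
    have : S * δ * S * (U * rdiag e * Uᴴ) = (S * δ * S * U * rdiag e) * Uᴴ := by
      simp only [Matrix.mul_assoc]
    rw [this, trace_mul_comm]
    have : Uᴴ * (S * δ * S * U * rdiag e) = (W * δ * Wᴴ) * rdiag e := by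
      rw [hWh, hW]; simp only [Matrix.mul_assoc]
    rw [this, trace, Complex.re_sum]
    refine Finset.sum_congr rfl fun i _ => ?_
    simp only [Matrix.diag, rdiag, mul_diagonal, hy]
    rw [mul_comm, Complex.re_ofReal_mul]
  have hb1 : ∀ i, (1 + c) * y i ≤ 1 := by
    intro i
    have h := conj_diag_nonneg hm.posSemidef W i
    have h' : M - δ = A - (1 + c) • δ := by rw [hAdef]; module
    rw [h', Matrix.mul_sub, Matrix.sub_mul, hWA, mul_smul_comm, smul_mul_assoc] at h
    simp only [Matrix.sub_apply, one_apply_eq, Matrix.smul_apply, Complex.sub_re, Complex.one_re,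
      Complex.real_smul, Complex.re_ofReal_mul] at h
    simp only [hy]
    linarith
  have hb2 : ∀ i, -1 ≤ (1 - c) * y i := by
    intro i
    have h := conj_diag_nonneg hp.posSemidef W i
    have h' : M + δ = A + (1 - c) • δ := by rw [hAdef]; module
    rw [h', Matrix.mul_add, Matrix.add_mul, hWA, mul_smul_comm, smul_mul_assoc] at h
    simp only [Matrix.add_apply, one_apply_eq, Matrix.smul_apply, Complex.add_re, Complex.one_re,
      Complex.real_smul, Complex.re_ofReal_mul] at h
    simp only [hy]
    linarith
  rw [htr]
  have key : ∀ i, e i * y i ≤ |e i| * ((1 / 2) * ((1 + c)⁻¹ + (1 - c)⁻¹)) +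
      e i * ((1 / 2) * ((1 + c)⁻¹ - (1 - c)⁻¹)) := by
    intro i
    have k1 : y i ≤ (1 + c)⁻¹ := by
      rw [← one_div, le_div_iff₀ (by linarith)]; linarith [hb1 i]
    have k2 : -(1 - c)⁻¹ ≤ y i := by
      rw [← one_div, ← neg_div, div_le_iff₀ (by linarith)]; linarith [hb2 i]
    rcases le_total 0 (e i) with h | h
    · rw [abs_of_nonneg h]
      nlinarith [mul_le_mul_of_nonneg_left k1 h]
    · rw [abs_of_nonpos h]
      nlinarith [mul_le_mul_of_nonneg_left k2 (neg_nonneg.2 h)]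
  calc ∑ i, e i * y i ≤ _ := Finset.sum_le_sum fun i _ => key i
    _ = _ := by rw [Finset.sum_add_distrib, ← Finset.sum_mul, ← Finset.sum_mul, he]; ring

lemma path_cont : Continuous (fun c : ℝ => M + c • δ) := by fun_prop

lemma k_bound (hp : (M + δ).PosDef) (hm : (M - δ).PosDef)
    (hU : Uᴴ * U = 1) (hδ : δ = U * rdiag e * Uᴴ) (he : ∑ i, e i = 0)
    {c : ℝ} (h1 : 0 ≤ c) (h2 : c < 1) :
    (δ * cfc Real.log (M + c • δ)).trace.re ≤
      (δ * cfc Real.log M).trace.re + (∑ i, |e i|) * phi' c := by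
  have hPD : ∀ x ∈ Icc 0 c, (M + x • δ).PosDef := fun x hx =>
    path_posDef hp hm (by linarith [hx.1]) (by linarith [hx.2])
  have hlc : ContinuousOn (fun x : ℝ => cfc Real.log (M + x • δ)) (Icc 0 c) :=
    cfc_contOn isOpen_Ioi (Real.continuousOn_log.mono fun x hx => ne_of_gt hx)
      path_cont.continuousOn (fun x hx => (hPD x hx).1) fun x hx => spec_pos (hPD x hx)
  have hsc : ContinuousOn (fun x : ℝ => cfc (fun x => (Real.sqrt x)⁻¹) (M + x • δ)) (Icc 0 c) := by
    refine cfc_contOn isOpen_Ioi ?_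
      path_cont.continuousOn (fun x hx => (hPD x hx).1) fun x hx => spec_pos (hPD x hx)
    exact Real.continuous_sqrt.continuousOn.inv₀ fun x hx => (Real.sqrt_pos.2 hx).ne'
  refine image_le_of_liminf_slope_right_le_deriv_boundary
    (f := fun x => (δ * cfc Real.log (M + x • δ)).trace.re)
    (B := fun x => (δ * cfc Real.log M).trace.re + (∑ i, |e i|) * phi' x)
    (B' := fun x => (∑ i, |e i|) * ((1 / 2) * ((1 + x)⁻¹ + (1 - x)⁻¹)))
    (a := 0) (b := c) ?_ ?_ ?_ ?_ ?_ (right_mem_Icc.2 h1)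
  · exact trace_re_cont.comp_continuousOn (continuousOn_const.mul hlc)
  · simp [phi'_zero]
  · intro x hx
    have := hasDerivAt_phi' (c := x) (by linarith [hx.1]) (by linarith [hx.2])
    exact ((this.const_mul _).const_add _).continuousAt.continuousWithinAt
  · intro x hx
    have := hasDerivAt_phi' (c := x) (by linarith [hx.1]) (by linarith [hx.2])
    exact ((this.const_mul _).const_add _).hasDerivWithinAt
  · intro x hx r hr
    have hxI : x ∈ Icc 0 c := ⟨hx.1, hx.2.le⟩
    set m : ℝ → ℝ := fun z => (cfc (fun x => (Real.sqrt x)⁻¹) (M + z • δ) * δ *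
      cfc (fun x => (Real.sqrt x)⁻¹) (M + x • δ) * δ).trace.re with hm'
    have hmx : m x < r := lt_of_le_of_lt (second_deriv_bound hp hm hU hδ he
      (by linarith [hx.1]) (by linarith [hx.2])) hr
    have hmc : ContinuousOn m (Icc 0 c) := trace_re_cont.comp_continuousOn
      (((hsc.mul continuousOn_const).mul continuousOn_const).mul continuousOn_const)
    have hmc' : Tendsto m (𝓝[>] x) (𝓝 (m x)) := by
      refine (hmc x hxI).tendsto.mono_left ?_
      exact nhdsWithin_le_iff.2 (mem_of_superset (Ioc_mem_nhdsGT hx.2)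
        fun z hz => ⟨hx.1.trans hz.1.le, hz.2⟩)
    have hev : ∀ᶠ z in 𝓝[>] x, slope (fun x => (δ * cfc Real.log (M + x • δ)).trace.re) x z < r := by
      filter_upwards [hmc'.eventually_lt_const hmx, Ioc_mem_nhdsGT hx.2] with z hz hzI
      refine lt_of_le_of_lt ?_ hz
      have hzx : 0 < z - x := sub_pos.2 hzI.1
      have hs := symm_bound (hPD x hxI) (hPD z ⟨hx.1.trans hzI.1.le, hzI.2⟩)
        (Δ := (z - x) • δ) (by module)
      simp only [smul_mul_assoc, mul_smul_comm, trace_smul, Complex.real_smul,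
        Complex.re_ofReal_mul] at hs
      rw [slope_def_field, div_le_iff₀ hzx]
      rw [Matrix.mul_sub, trace_sub, Complex.sub_re] at hs
      have := le_of_mul_le_mul_left hs hzx
      rw [hm']; simp only
      linarith
    exact hev.frequently

lemma g_bound (hM : M.IsHermitian) (hp : (M + δ).PosDef) (hm : (M - δ).PosDef)
    (hU : Uᴴ * U = 1) (hδ : δ = U * rdiag e * Uᴴ) (he : ∑ i, e i = 0)
    {c : ℝ} (h1 : 0 ≤ c) (h2 : c < 1) :
    -vN (M + c • δ) ≤ -vN M + (δ * cfc Real.log M).trace.re * c + (∑ i, |e i|) * phi c := by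
  have hPD : ∀ x ∈ Icc 0 c, (M + x • δ).PosDef := fun x hx =>
    path_posDef hp hm (by linarith [hx.1]) (by linarith [hx.2])
  have hlc : ContinuousOn (fun x : ℝ => cfc Real.log (M + x • δ)) (Icc 0 c) :=
    cfc_contOn isOpen_Ioi (Real.continuousOn_log.mono fun x hx => ne_of_gt hx)
      path_cont.continuousOn (fun x hx => (hPD x hx).1) fun x hx => spec_pos (hPD x hx)
  have hδtr : δ.trace = 0 := by
    rw [hδ, trace_mul_comm, ← Matrix.mul_assoc, hU, Matrix.one_mul]
    simp only [rdiag, trace_diagonal]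
    rw [← Complex.ofReal_sum, he, Complex.ofReal_zero]
  refine image_le_of_liminf_slope_right_le_deriv_boundary
    (f := fun x => -vN (M + x • δ))
    (B := fun x => -vN M + (δ * cfc Real.log M).trace.re * x + (∑ i, |e i|) * phi x)
    (B' := fun x => (δ * cfc Real.log M).trace.re + (∑ i, |e i|) * phi' x)
    (a := 0) (b := c) ?_ ?_ ?_ ?_ ?_ (right_mem_Icc.2 h1)
  · exact (vN_contOn path_cont.continuousOn fun x hx => (hPD x hx).1).neg
  · simp [phi_zero]
  · have := phi_cont
    fun_prop
  · intro x hx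
    have := hasDerivAt_phi (c := x) (by linarith [hx.1]) (by linarith [hx.2])
    have h := (((hasDerivAt_id x).const_mul (δ * cfc Real.log M).trace.re).const_add (-vN M)).add
      (this.const_mul (∑ i, |e i|))
    rw [mul_one] at h
    exact h.hasDerivWithinAt
  · intro x hx r hr
    have hxI : x ∈ Icc 0 c := ⟨hx.1, hx.2.le⟩
    set m : ℝ → ℝ := fun z => (δ * cfc Real.log (M + z • δ)).trace.re with hm'
    have hmx : m x < r := lt_of_le_of_lt (k_bound hp hm hU hδ he hx.1 (by linarith [hx.2])) hr
    have hmc : ContinuousOn m (Icc 0 c) := trace_re_cont.comp_continuousOn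
      (continuousOn_const.mul hlc)
    have hmc' : Tendsto m (𝓝[>] x) (𝓝 (m x)) := by
      refine (hmc x hxI).tendsto.mono_left ?_
      exact nhdsWithin_le_iff.2 (mem_of_superset (Ioc_mem_nhdsGT hx.2)
        fun z hz => ⟨hx.1.trans hz.1.le, hz.2⟩)
    have hev : ∀ᶠ z in 𝓝[>] x, slope (fun x => -vN (M + x • δ)) x z < r := by
      filter_upwards [hmc'.eventually_lt_const hmx, Ioc_mem_nhdsGT hx.2] with z hz hzI
      refine lt_of_le_of_lt ?_ hz
      have hzx : 0 < z - x := sub_pos.2 hzI.1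
      have hzP := hPD z ⟨hx.1.trans hzI.1.le, hzI.2⟩
      have hs := klein (hPD x hxI) hzP
      have e1 := trace_mul_log hzP.1
      have e2 : ((M + x • δ) * cfc Real.log (M + z • δ)).trace.re =
          ((M + z • δ) * cfc Real.log (M + z • δ)).trace.re -
            (z - x) * (δ * cfc Real.log (M + z • δ)).trace.re := by
        rw [← Complex.re_ofReal_mul, ← Complex.sub_re, ← Complex.real_smul, ← trace_smul,
          ← trace_sub, ← smul_mul_assoc, ← Matrix.sub_mul]
        congr 4
        module
      rw [relD, e2, e1] at hs
      simp only [trace_add, trace_smul, hδtr, smul_zero] at hs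
      rw [slope_def_field, div_le_iff₀ hzx, hm']
      simp only
      linarith
    exact hev.frequently

/-- Part (B) of the proof. -/
lemma partB (hM : M.IsHermitian) (hp : (M + δ).PosDef) (hm : (M - δ).PosDef)
    (hU : Uᴴ * U = 1) (hδ : δ = U * rdiag e * Uᴴ) (he : ∑ i, e i = 0)
    {c : ℝ} (h1 : -1 < c) (h2 : c < 1) :
    2 * vN M - 2 * (∑ i, |e i|) * phi c ≤ vN (M + c • δ) + vN (M - c • δ) := by
  wlog hc : 0 ≤ c generalizing c
  · have := this (c := -c) (by linarith) (by linarith) (by linarith)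
    simp only [phi_neg, neg_smul, sub_neg_eq_add, ← sub_eq_add_neg] at this
    linarith
  have b1 := g_bound hM hp hm hU hδ he hc h2
  have b2 := g_bound (δ := -δ) (e := fun i => -e i) hM (by simpa [← sub_eq_add_neg] using hm)
    (by simpa using hp) hU ?_ (by simp [he]) hc h2
  · simp only [smul_neg, ← sub_eq_add_neg, abs_neg, Matrix.neg_mul, trace_neg, Complex.neg_re] at b2
    linarith
  · have : rdiag (fun i => -e i) = - rdiag e := by
      simp [rdiag, diagonal_neg]
    rw [this, hδ]; simp

end bpart

section core
open Set Filter Topology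
variable {ι κ : Type} [Fintype ι] [DecidableEq ι] [Fintype κ] [DecidableEq κ]

lemma phi_convex : ConvexOn ℝ (Icc (-1) 1) phi := by
  refine ⟨convex_Icc _ _, ?_⟩
  intro x hx y hy a b ha hb hab
  have h := Real.convexOn_mul_log
  have h1 := h.2 (x := 1 + x) (by simp only [mem_Ici]; linarith [hx.1]) (y := 1 + y)
    (by simp only [mem_Ici]; linarith [hy.1]) ha hb hab
  have h2 := h.2 (x := 1 - x) (by simp only [mem_Ici]; linarith [hx.2]) (y := 1 - y)
    (by simp only [mem_Ici]; linarith [hy.2]) ha hb hab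
  simp only [smul_eq_mul] at *
  have e1 : a * (1 + x) + b * (1 + y) = 1 + (a * x + b * y) := by linear_combination hab
  have e2 : a * (1 - x) + b * (1 - y) = 1 - (a * x + b * y) := by linear_combination hab
  rw [e1] at h1
  rw [e2] at h2
  unfold phi
  linarith

lemma phi_abs (c : ℝ) : phi |c| = phi c := by
  rcases abs_choice c with h | h <;> rw [h]
  exact phi_neg c

lemma phi_nonneg {c : ℝ} (h : c ∈ Icc (-1 : ℝ) 1) : 0 ≤ phi c := by
  have h1 := phi_convex.2 h (show -c ∈ Icc (-1 : ℝ) 1 from ⟨by linarith [h.2], by linarith [h.1]⟩)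
    (show (0 : ℝ) ≤ 1 / 2 by norm_num) (show (0 : ℝ) ≤ 1 / 2 by norm_num) (by norm_num)
  rw [phi_neg] at h1
  simp only [smul_eq_mul] at h1
  rw [show (1 / 2 : ℝ) * c + 1 / 2 * -c = 0 by ring, phi_zero] at h1
  linarith

lemma phi_mono {a b : ℝ} (ha : 0 ≤ a) (hab : a ≤ b) (hb : b ≤ 1) : phi a ≤ phi b := by
  rcases eq_or_lt_of_le (ha.trans hab) with h0 | h0
  · have : a = b := by linarith
    rw [this]
  have hbI : b ∈ Icc (-1 : ℝ) 1 := ⟨by linarith, hb⟩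
  have h1 := phi_convex.2 hbI (show (0 : ℝ) ∈ Icc (-1 : ℝ) 1 from ⟨by norm_num, by norm_num⟩)
    (show 0 ≤ a / b by positivity)
    (show 0 ≤ 1 - a / b by rw [sub_nonneg, div_le_one h0]; exact hab) (by ring)
  simp only [smul_eq_mul, mul_zero, add_zero, phi_zero] at h1
  rw [div_mul_cancel₀ _ h0.ne'] at h1
  have : a / b ≤ 1 := by rw [div_le_one h0]; exact hab
  nlinarith [phi_nonneg hbI]

lemma T_le_one {M δ U : Matrix ι ι ℂ} {e : ι → ℝ} (hp : (M + δ).PosSemidef)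
    (hm : (M - δ).PosSemidef) (hU : Uᴴ * U = 1) (hU' : U * Uᴴ = 1) (hδ : δ = U * rdiag e * Uᴴ)
    (hM : M.trace = 1) : ∑ i, |e i| ≤ 1 := by
  have hd : Uᴴ * δ * U = rdiag e := by
    rw [hδ]
    calc Uᴴ * (U * rdiag e * Uᴴ) * U = (Uᴴ * U) * rdiag e * (Uᴴ * U) := by
          simp only [Matrix.mul_assoc]
      _ = _ := by rw [hU, Matrix.one_mul, Matrix.mul_one]
  have h1 : ∀ i, |e i| ≤ ((Uᴴ * M * U) i i).re := by
    intro i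
    have a1 := conj_diag_nonneg hp Uᴴ i
    have a2 := conj_diag_nonneg hm Uᴴ i
    rw [conjTranspose_conjTranspose, Matrix.mul_add, Matrix.add_mul, hd] at a1
    rw [conjTranspose_conjTranspose, Matrix.mul_sub, Matrix.sub_mul, hd] at a2
    simp only [Matrix.add_apply, Matrix.sub_apply, rdiag, diagonal_apply_eq, Complex.add_re,
      Complex.sub_re, Complex.ofReal_re] at a1 a2
    rw [abs_le]; constructor <;> linarith
  calc ∑ i, |e i| ≤ ∑ i, ((Uᴴ * M * U) i i).re := Finset.sum_le_sum fun i _ => h1 i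
    _ = (Uᴴ * M * U).trace.re := by rw [trace, Complex.re_sum]; rfl
    _ = 1 := by
      rw [Matrix.mul_assoc, trace_mul_comm, Matrix.mul_assoc, hU', Matrix.mul_one, hM]; simp

lemma blk_kron (A : Matrix ι ι ℂ) (hA : A.IsHermitian) (B : Matrix κ κ ℂ) (b : ι) :
    blk b (A ⊗ₖ B) = (A b b).re • B := by
  have h : ((A b b).re : ℂ) = A b b := hA.coe_re_apply_self b
  ext i j
  simp only [blk, submatrix_apply, kroneckerMap_apply, Matrix.smul_apply, Complex.real_smul]
  rw [h]

lemma scal_id {r0 r1 : ℝ} (h0 : 0 < r0) (h1 : 0 < r1) :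
    2 * Real.negMulLog ((r0 + r1) / 2) - Real.negMulLog r0 - Real.negMulLog r1 =
      2 * ((r0 + r1) / 2) * phi ((r0 - r1) / (r0 + r1)) := by
  have e0 : 1 + (r0 - r1) / (r0 + r1) = r0 / ((r0 + r1) / 2) := by field_simp; ring
  have e1 : 1 - (r0 - r1) / (r0 + r1) = r1 / ((r0 + r1) / 2) := by field_simp; ring
  have hp : 0 < (r0 + r1) / 2 := by linarith
  simp only [phi, Real.negMulLog, e0, e1, Real.log_div h0.ne' hp.ne', Real.log_div h1.ne' hp.ne']
  field_simp
  ring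

lemma core_diag {σ₀ σ₁ : Matrix ι ι ℂ} {τ₀ τ₁ U : Matrix κ κ ℂ} {a : ι → ℝ} {e : κ → ℝ}
    (hσ0 : σ₀.PosDef) (hσ1 : σ₁.PosDef) (hτ0 : τ₀.PosDef) (hτ1 : τ₁.PosDef)
    (tσ0 : σ₀.trace = 1) (tσ1 : σ₁.trace = 1) (tτ0 : τ₀.trace = 1) (tτ1 : τ₁.trace = 1)
    (ha : (1 / 2 : ℝ) • (σ₀ - σ₁) = rdiag a)
    (hU : Uᴴ * U = 1) (hU' : U * Uᴴ = 1) (he : (1 / 2 : ℝ) • (τ₀ - τ₁) = U * rdiag e * Uᴴ) :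
    (1 - ∑ i, |e i|) * phi (∑ i, |a i|) ≤
      (1 / 2) * vN ((1 / 2 : ℝ) • (σ₀ ⊗ₖ τ₀ + σ₁ ⊗ₖ τ₁)) +
      (1 / 2) * vN ((1 / 2 : ℝ) • (σ₀ ⊗ₖ τ₁ + σ₁ ⊗ₖ τ₀)) -
      (1 / 2) * vN σ₀ - (1 / 2) * vN σ₁ - vN ((1 / 2 : ℝ) • (τ₀ + τ₁)) := by
  set δ := (1 / 2 : ℝ) • (τ₀ - τ₁) with hδ
  set M := (1 / 2 : ℝ) • (τ₀ + τ₁) with hM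
  have hMp : M + δ = τ₀ := by rw [hM, hδ]; module
  have hMm : M - δ = τ₁ := by rw [hM, hδ]; module
  have hMtr : M.trace = 1 := by
    rw [hM, trace_smul, trace_add, tτ0, tτ1, Complex.real_smul]; norm_num
  have hδtr : δ.trace = 0 := by
    rw [hδ, trace_smul, trace_sub, tτ0, tτ1]; simp
  have hMh : M.IsHermitian := ((hτ0.add hτ1).smul (by norm_num : (0 : ℝ) < 1 / 2)).1
  have hse : ∑ i, e i = 0 := by
    have : (U * rdiag e * Uᴴ).trace = 0 := by rw [← he, hδtr]
    rw [trace_mul_comm, ← Matrix.mul_assoc, hU, Matrix.one_mul, rdiag, trace_diagonal,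
      ← Complex.ofReal_sum] at this
    exact_mod_cast this
  have hT : ∑ i, |e i| ≤ 1 := T_le_one (by rw [hMp]; exact hτ0.posSemidef)
    (by rw [hMm]; exact hτ1.posSemidef) hU hU' he hMtr
  set r0 : ι → ℝ := fun b => (σ₀ b b).re with hr0
  set r1 : ι → ℝ := fun b => (σ₁ b b).re with hr1
  have p0 : ∀ b, 0 < r0 b := fun b => (Complex.lt_def.1 (hσ0.diag_pos (i := b))).1
  have p1 : ∀ b, 0 < r1 b := fun b => (Complex.lt_def.1 (hσ1.diag_pos (i := b))).1
  have s0 : ∑ b, r0 b = 1 := by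
    have : (∑ b, r0 b) = σ₀.trace.re := by rw [trace, Complex.re_sum]; rfl
    rw [this, tσ0]; simp
  have s1 : ∑ b, r1 b = 1 := by
    have : (∑ b, r1 b) = σ₁.trace.re := by rw [trace, Complex.re_sum]; rfl
    rw [this, tσ1]; simp
  have hab : ∀ b, a b = (r0 b - r1 b) / 2 := by
    intro b
    have := congrArg (fun X : Matrix ι ι ℂ => (X b b).re) ha
    simp only [rdiag, diagonal_apply_eq, Matrix.smul_apply, Matrix.sub_apply, Complex.ofReal_re,
      Complex.real_smul, Complex.re_ofReal_mul, Complex.sub_re] at this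
    rw [← this]; simp only [hr0, hr1]; ring
  -- pinching
  have hpd : ∀ {A B : Matrix ι ι ℂ} {C D : Matrix κ κ ℂ}, A.PosDef → B.PosDef → C.PosDef →
      D.PosDef → ((1 / 2 : ℝ) • (A ⊗ₖ C + B ⊗ₖ D)).PosDef := fun hA hB hC hD =>
    ((hA.kronecker hC).add (hB.kronecker hD)).smul (by norm_num : (0 : ℝ) < 1 / 2)
  have P0 := pinch_holevo (hσ0.kronecker hτ0) (hσ1.kronecker hτ1) (hpd hσ0 hσ1 hτ0 hτ1)
    (by module)
  have P1 := pinch_holevo (hσ0.kronecker hτ1) (hσ1.kronecker hτ0) (hpd hσ0 hσ1 hτ1 hτ0)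
    (by module)
  set ω0 := (1 / 2 : ℝ) • (σ₀ ⊗ₖ τ₀ + σ₁ ⊗ₖ τ₁) with hω0
  set ω1 := (1 / 2 : ℝ) • (σ₀ ⊗ₖ τ₁ + σ₁ ⊗ₖ τ₀) with hω1
  rw [vN_kron hσ0.1 hτ0.1, vN_kron hσ1.1 hτ1.1] at P0
  rw [vN_kron hσ0.1 hτ1.1, vN_kron hσ1.1 hτ0.1] at P1
  set c : ι → ℝ := fun b => (r0 b - r1 b) / (r0 b + r1 b) with hc
  have hc1 : ∀ b, -1 < c b := fun b => by
    rw [hc]; simp only; rw [lt_div_iff₀ (by linarith [p0 b, p1 b])]; linarith [p0 b]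
  have hc2 : ∀ b, c b < 1 := fun b => by
    rw [hc]; simp only; rw [div_lt_iff₀ (by linarith [p0 b, p1 b])]; linarith [p1 b]
  have bω0 : ∀ b, blk b ω0 = ((r0 b + r1 b) / 2) • (M + c b • δ) := by
    intro b
    have : blk b ω0 = (1 / 2 : ℝ) • (blk b (σ₀ ⊗ₖ τ₀) + blk b (σ₁ ⊗ₖ τ₁)) := rfl
    rw [this, blk_kron _ hσ0.1, blk_kron _ hσ1.1, hM, hδ]
    change (1 / 2 : ℝ) • (r0 b • τ₀ + r1 b • τ₁) = _
    have hne : r0 b + r1 b ≠ 0 := by linarith [p0 b, p1 b]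
    simp only [hc]
    match_scalars <;> field_simp <;> ring
  have bω1 : ∀ b, blk b ω1 = ((r0 b + r1 b) / 2) • (M - c b • δ) := by
    intro b
    have : blk b ω1 = (1 / 2 : ℝ) • (blk b (σ₀ ⊗ₖ τ₁) + blk b (σ₁ ⊗ₖ τ₀)) := rfl
    rw [this, blk_kron _ hσ0.1, blk_kron _ hσ1.1, hM, hδ]
    change (1 / 2 : ℝ) • (r0 b • τ₁ + r1 b • τ₀) = _
    have hne : r0 b + r1 b ≠ 0 := by linarith [p0 b, p1 b]
    simp only [hc]
    match_scalars <;> field_simp <;> ring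
  have hhp : ∀ b, (M + c b • δ).IsHermitian := fun b =>
    (path_posDef (by rw [hMp]; exact hτ0) (by rw [hMm]; exact hτ1) (hc1 b) (hc2 b)).1
  have hhm : ∀ b, (M - c b • δ).IsHermitian := fun b => by
    have := (path_posDef (c := -c b) (by rw [hMp]; exact hτ0) (by rw [hMm]; exact hτ1)
      (by linarith [hc2 b]) (by linarith [hc1 b])).1
    rwa [neg_smul, ← sub_eq_add_neg] at this
  have vω0 : ∀ b, vN (blk b ω0) = (r0 b + r1 b) / 2 * vN (M + c b • δ) +
      Real.negMulLog ((r0 b + r1 b) / 2) := by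
    intro b
    rw [bω0, vN_smul (hhp b), trace_add, hMtr, trace_smul, hδtr]; simp
  have vω1 : ∀ b, vN (blk b ω1) = (r0 b + r1 b) / 2 * vN (M - c b • δ) +
      Real.negMulLog ((r0 b + r1 b) / 2) := by
    intro b
    rw [bω1, vN_smul (hhm b), trace_sub, hMtr, trace_smul, hδtr]; simp
  have vk : ∀ {A : Matrix ι ι ℂ} {C : Matrix κ κ ℂ} (hA : A.IsHermitian) (hC : C.IsHermitian)
      (tC : C.trace = 1) b, vN (blk b (A ⊗ₖ C)) = (A b b).re * vN C +
        Real.negMulLog (A b b).re := by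
    intro A C hA hC tC b
    rw [blk_kron _ hA, vN_smul hC, tC]; simp
  simp only [vk hσ0.1 hτ0.1 tτ0, vk hσ1.1 hτ1.1 tτ1] at P0
  simp only [vk hσ0.1 hτ1.1 tτ1, vk hσ1.1 hτ0.1 tτ0] at P1
  simp only [tσ0, tσ1, tτ0, tτ1, Complex.one_re, one_mul] at P0 P1
  have key : ∀ b, 2 * ((r0 b + r1 b) / 2 * (2 * vN M)) +
        4 * (1 - ∑ i, |e i|) * ((r0 b + r1 b) / 2 * phi (c b)) -
        (r0 b + r1 b) * (vN τ₀ + vN τ₁) ≤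
      (2 * vN (blk b ω0) - (r0 b * vN τ₀ + Real.negMulLog (r0 b)) -
        (r1 b * vN τ₁ + Real.negMulLog (r1 b))) +
      (2 * vN (blk b ω1) - (r0 b * vN τ₁ + Real.negMulLog (r0 b)) -
        (r1 b * vN τ₀ + Real.negMulLog (r1 b))) := by
    intro b
    have hB := partB hMh (by rw [hMp]; exact hτ0) (by rw [hMm]; exact hτ1) hU he hse
      (hc1 b) (hc2 b)
    have hS := scal_id (p0 b) (p1 b)
    have hp : 0 ≤ (r0 b + r1 b) / 2 := by linarith [p0 b, p1 b]
    have hB' := mul_le_mul_of_nonneg_left hB hp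
    rw [vω0, vω1]
    change _ = 2 * ((r0 b + r1 b) / 2) * phi (c b) at hS
    linarith
  have hsum := Finset.sum_le_sum fun b (_ : b ∈ Finset.univ) => key b
  rw [Finset.sum_add_distrib (f := fun b => (2 * vN (blk b ω0) - _ - _))] at hsum
  have hw : ∑ b, (r0 b + r1 b) / 2 = 1 := by
    rw [← Finset.sum_div, Finset.sum_add_distrib, s0, s1]; norm_num
  have hl : ∑ b, (2 * ((r0 b + r1 b) / 2 * (2 * vN M)) +
        4 * (1 - ∑ i, |e i|) * ((r0 b + r1 b) / 2 * phi (c b)) -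
        (r0 b + r1 b) * (vN τ₀ + vN τ₁)) = 4 * vN M +
        4 * (1 - ∑ i, |e i|) * ∑ b, ((r0 b + r1 b) / 2 * phi (c b)) - 2 * (vN τ₀ + vN τ₁) := by
    rw [Finset.sum_sub_distrib, Finset.sum_add_distrib, ← Finset.mul_sum, ← Finset.sum_mul,
      ← Finset.mul_sum, ← Finset.sum_mul, hw, Finset.sum_add_distrib, s0, s1]
    ring
  rw [hl] at hsum
  have hJ : phi (∑ i, |a i|) ≤ ∑ b, ((r0 b + r1 b) / 2 * phi (c b)) := by
    have := phi_convex.map_sum_le (t := Finset.univ) (w := fun b => (r0 b + r1 b) / 2)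
      (p := fun b => |c b|) (fun b _ => by linarith [p0 b, p1 b]) hw
      (fun b _ => ⟨by linarith [abs_nonneg (c b)], abs_le.2 ⟨(hc1 b).le, (hc2 b).le⟩⟩)
    simp only [smul_eq_mul, phi_abs] at this
    have heq : ∑ i, |a i| = ∑ b, (r0 b + r1 b) / 2 * |c b| := ?_
    · rw [heq]; exact this
    refine Finset.sum_congr rfl fun b _ => ?_
    have hne : 0 < r0 b + r1 b := by linarith [p0 b, p1 b]
    rw [hab, hc, abs_div, abs_div, abs_of_pos hne]
    rw [abs_of_pos (show (0 : ℝ) < 2 by norm_num)]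
    field_simp
  have hJ' := mul_le_mul_of_nonneg_left hJ (sub_nonneg.2 hT)
  have hfin := hsum.trans (add_le_add P0 P1)
  linarith

end core

section limits
open Set Filter Topology
variable {ι κ : Type} [Fintype ι] [DecidableEq ι] [Fintype κ] [DecidableEq κ]

lemma core_pd {σ₀ σ₁ W : Matrix ι ι ℂ} {τ₀ τ₁ U : Matrix κ κ ℂ} {a : ι → ℝ} {e : κ → ℝ}
    (hσ0 : σ₀.PosDef) (hσ1 : σ₁.PosDef) (hτ0 : τ₀.PosDef) (hτ1 : τ₁.PosDef)
    (tσ0 : σ₀.trace = 1) (tσ1 : σ₁.trace = 1) (tτ0 : τ₀.trace = 1) (tτ1 : τ₁.trace = 1)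
    (hW : Wᴴ * W = 1) (hW' : W * Wᴴ = 1) (ha : (1 / 2 : ℝ) • (σ₀ - σ₁) = W * rdiag a * Wᴴ)
    (hU : Uᴴ * U = 1) (hU' : U * Uᴴ = 1) (he : (1 / 2 : ℝ) • (τ₀ - τ₁) = U * rdiag e * Uᴴ) :
    (1 - ∑ i, |e i|) * phi (∑ i, |a i|) ≤
      (1 / 2) * vN ((1 / 2 : ℝ) • (σ₀ ⊗ₖ τ₀ + σ₁ ⊗ₖ τ₁)) +
      (1 / 2) * vN ((1 / 2 : ℝ) • (σ₀ ⊗ₖ τ₁ + σ₁ ⊗ₖ τ₀)) -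
      (1 / 2) * vN σ₀ - (1 / 2) * vN σ₁ - vN ((1 / 2 : ℝ) • (τ₀ + τ₁)) := by
  have hWu : IsUnit W := ⟨⟨W, Wᴴ, hW', hW⟩, rfl⟩
  have pd : ∀ {A : Matrix ι ι ℂ}, A.PosDef → (Wᴴ * A * W).PosDef := fun hA =>
    (IsUnit.posDef_star_left_conjugate_iff hWu).2 hA
  have tr : ∀ {A : Matrix ι ι ℂ}, A.trace = 1 → (Wᴴ * A * W).trace = 1 := by
    intro A hA
    rw [Matrix.mul_assoc, trace_mul_comm, Matrix.mul_assoc, hW', Matrix.mul_one, hA]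
  have hd : (1 / 2 : ℝ) • (Wᴴ * σ₀ * W - Wᴴ * σ₁ * W) = rdiag a := by
    rw [← Matrix.sub_mul, ← Matrix.mul_sub, ← smul_mul_assoc, ← mul_smul_comm, ha]
    calc Wᴴ * (W * rdiag a * Wᴴ) * W = (Wᴴ * W) * rdiag a * (Wᴴ * W) := by
          simp only [Matrix.mul_assoc]
      _ = _ := by rw [hW, Matrix.one_mul, Matrix.mul_one]
  have h := core_diag (pd hσ0) (pd hσ1) hτ0 hτ1 (tr tσ0) (tr tσ1) tτ0 tτ1 hd hU hU' he
  rw [vN_unitary hσ0.1 hW', vN_unitary hσ1.1 hW'] at h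
  have hk : ∀ (A : Matrix ι ι ℂ) (C : Matrix κ κ ℂ), (Wᴴ * A * W) ⊗ₖ C =
      (W ⊗ₖ (1 : Matrix κ κ ℂ))ᴴ * (A ⊗ₖ C) * (W ⊗ₖ (1 : Matrix κ κ ℂ)) := by
    intro A C
    rw [conjTranspose_kronecker, conjTranspose_one, ← mul_kronecker_mul, ← mul_kronecker_mul,
      Matrix.one_mul, Matrix.mul_one]
  have hV : (W ⊗ₖ (1 : Matrix κ κ ℂ)) * (W ⊗ₖ (1 : Matrix κ κ ℂ))ᴴ = 1 := by
    rw [conjTranspose_kronecker, conjTranspose_one, ← mul_kronecker_mul, hW', Matrix.mul_one,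
      one_kronecker_one]
  have hω : ∀ {A B : Matrix ι ι ℂ} {C D : Matrix κ κ ℂ}, A.PosDef → B.PosDef → C.PosDef →
      D.PosDef → vN ((1 / 2 : ℝ) • ((Wᴴ * A * W) ⊗ₖ C + (Wᴴ * B * W) ⊗ₖ D)) =
        vN ((1 / 2 : ℝ) • (A ⊗ₖ C + B ⊗ₖ D)) := by
    intro A B C D hA hB hC hD
    have hp : ((1 / 2 : ℝ) • (A ⊗ₖ C + B ⊗ₖ D)).PosDef :=
      ((hA.kronecker hC).add (hB.kronecker hD)).smul (by norm_num : (0 : ℝ) < 1 / 2)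
    rw [hk, hk, ← Matrix.add_mul, ← Matrix.mul_add, ← smul_mul_assoc, ← mul_smul_comm,
      vN_unitary hp.1 hV]
  rw [hω hσ0 hσ1 hτ0 hτ1, hω hσ0 hσ1 hτ1 hτ0] at h
  exact h

/-- mixing with the maximally mixed state -/
noncomputable def pert (x : ℝ) (ρ : Matrix ι ι ℂ) : Matrix ι ι ℂ :=
  (1 - x) • ρ + (x / Fintype.card ι) • (1 : Matrix ι ι ℂ)

lemma pert_zero (ρ : Matrix ι ι ℂ) : pert 0 ρ = ρ := by simp [pert]

lemma pert_psd {ρ : Matrix ι ι ℂ} (h : ρ.PosSemidef) {x : ℝ} (hx : x ∈ Icc (0 : ℝ) 1) :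
    (pert x ρ).PosSemidef :=
  (h.smul (sub_nonneg.2 hx.2)).add
    (PosSemidef.one.smul (div_nonneg hx.1 (Nat.cast_nonneg _)))

lemma pert_pd [Nonempty ι] {ρ : Matrix ι ι ℂ} (h : ρ.PosSemidef) {x : ℝ} (hx : x ∈ Ioc (0 : ℝ) 1) :
    (pert x ρ).PosDef :=
  PosDef.posSemidef_add (h.smul (sub_nonneg.2 hx.2))
    (PosDef.one.smul (div_pos hx.1 (Nat.cast_pos.2 Fintype.card_pos)))

lemma pert_trace [Nonempty ι] {ρ : Matrix ι ι ℂ} (h : ρ.trace = 1) (x : ℝ) :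
    (pert x ρ).trace = 1 := by
  have : (Fintype.card ι : ℂ) ≠ 0 := Nat.cast_ne_zero.2 Fintype.card_ne_zero
  rw [pert, trace_add, trace_smul, trace_smul, h, trace_one]
  simp only [Complex.real_smul]
  push_cast
  field_simp
  ring

lemma pert_cont (ρ : Matrix ι ι ℂ) : Continuous (fun x => pert x ρ) := by
  unfold pert; fun_prop

lemma kron_cont {A : ℝ → Matrix ι ι ℂ} {B : ℝ → Matrix κ κ ℂ} (hA : Continuous A)
    (hB : Continuous B) : Continuous (fun x => A x ⊗ₖ B x) := by
  refine continuous_matrix fun i j => ?_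
  simp only [kroneckerMap_apply]
  exact (hA.matrix_elem _ _).mul (hB.matrix_elem _ _)

lemma limit_le {f g : ℝ → ℝ} (hf : ContinuousOn f (Icc 0 1)) (hg : ContinuousOn g (Icc 0 1))
    (h : ∀ x ∈ Ioc (0 : ℝ) 1, f x ≤ g x) : f 0 ≤ g 0 := by
  have hle : 𝓝[>] (0 : ℝ) ≤ 𝓝[Icc 0 1] 0 := nhdsWithin_le_iff.2
    (mem_of_superset (Ioc_mem_nhdsGT zero_lt_one) Ioc_subset_Icc_self)
  have h0 : (0 : ℝ) ∈ Icc (0 : ℝ) 1 := ⟨le_rfl, zero_le_one⟩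
  refine le_of_tendsto_of_tendsto ((hf 0 h0).tendsto.mono_left hle)
    ((hg 0 h0).tendsto.mono_left hle) ?_
  filter_upwards [Ioc_mem_nhdsGT (zero_lt_one (α := ℝ))] with x hx using h x hx

lemma nonempty_of_trace {ρ : Matrix ι ι ℂ} (h : ρ.trace = 1) : Nonempty ι := by
  by_contra hn
  rw [not_nonempty_iff] at hn
  simp [trace] at h

lemma pert_diff {ρ₀ ρ₁ W : Matrix ι ι ℂ} {a : ι → ℝ}
    (ha : (1 / 2 : ℝ) • (ρ₀ - ρ₁) = W * rdiag a * Wᴴ) (x : ℝ) :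
    (1 / 2 : ℝ) • (pert x ρ₀ - pert x ρ₁) = W * rdiag (fun i => (1 - x) * a i) * Wᴴ := by
  have h1 : rdiag (fun i => (1 - x) * a i) = (1 - x) • rdiag a := by
    ext i j
    by_cases hij : i = j
    · subst hij; simp [rdiag]
    · simp [rdiag, hij]
  rw [h1, mul_smul_comm, smul_mul_assoc, ← ha]
  unfold pert
  module

lemma core_psd {σ₀ σ₁ W : Matrix ι ι ℂ} {τ₀ τ₁ U : Matrix κ κ ℂ} {a : ι → ℝ} {e : κ → ℝ}
    (hσ0 : σ₀.PosSemidef) (hσ1 : σ₁.PosSemidef) (hτ0 : τ₀.PosSemidef) (hτ1 : τ₁.PosSemidef)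
    (tσ0 : σ₀.trace = 1) (tσ1 : σ₁.trace = 1) (tτ0 : τ₀.trace = 1) (tτ1 : τ₁.trace = 1)
    (hW : Wᴴ * W = 1) (hW' : W * Wᴴ = 1) (ha : (1 / 2 : ℝ) • (σ₀ - σ₁) = W * rdiag a * Wᴴ)
    (hU : Uᴴ * U = 1) (hU' : U * Uᴴ = 1) (he : (1 / 2 : ℝ) • (τ₀ - τ₁) = U * rdiag e * Uᴴ) :
    (1 - ∑ i, |e i|) * phi (∑ i, |a i|) ≤
      (1 / 2) * vN ((1 / 2 : ℝ) • (σ₀ ⊗ₖ τ₀ + σ₁ ⊗ₖ τ₁)) +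
      (1 / 2) * vN ((1 / 2 : ℝ) • (σ₀ ⊗ₖ τ₁ + σ₁ ⊗ₖ τ₀)) -
      (1 / 2) * vN σ₀ - (1 / 2) * vN σ₁ - vN ((1 / 2 : ℝ) • (τ₀ + τ₁)) := by
  have := nonempty_of_trace tσ0
  have := nonempty_of_trace tτ0
  have key : ∀ x ∈ Ioc (0 : ℝ) 1, _ := fun x hx =>
    core_pd (pert_pd hσ0 hx) (pert_pd hσ1 hx) (pert_pd hτ0 hx) (pert_pd hτ1 hx)
      (pert_trace tσ0 x) (pert_trace tσ1 x) (pert_trace tτ0 x) (pert_trace tτ1 x)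
      hW hW' (pert_diff ha x) hU hU' (pert_diff he x)
  have h := limit_le ?_ ?_ key
  · simpa only [pert_zero, sub_zero, one_mul] using h
  · have := phi_cont
    fun_prop
  · have hv : ∀ {A : Matrix ι ι ℂ}, A.PosSemidef →
        ContinuousOn (fun x => vN (pert x A)) (Icc 0 1) := fun hA =>
      vN_contOn (pert_cont _).continuousOn fun x hx => (pert_psd hA hx).1
    have hvs : ContinuousOn (fun x => vN ((1 / 2 : ℝ) • (pert x τ₀ + pert x τ₁))) (Icc 0 1) := by
      refine vN_contOn ?_ fun x hx => ?_
      · have u1 := pert_cont τ₀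
        have u2 := pert_cont τ₁
        fun_prop
      · exact (((pert_psd hτ0 hx).add (pert_psd hτ1 hx)).smul
          (by norm_num : (0 : ℝ) ≤ 1 / 2)).1
    have hω : ∀ {A B : Matrix ι ι ℂ} {C D : Matrix κ κ ℂ}, A.PosSemidef → B.PosSemidef →
        C.PosSemidef → D.PosSemidef → ContinuousOn (fun x =>
          vN ((1 / 2 : ℝ) • (pert x A ⊗ₖ pert x C + pert x B ⊗ₖ pert x D))) (Icc 0 1) := by
      intro A B C D hA hB hC hD
      refine vN_contOn ?_ fun x hx => ?_
      · have u1 := kron_cont (pert_cont A) (pert_cont C)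
        have u2 := kron_cont (pert_cont B) (pert_cont D)
        exact (Continuous.const_smul (u1.fun_add u2) (1 / 2 : ℝ)).continuousOn
      · exact ((((pert_psd hA hx).kronecker (pert_psd hC hx)).add
          ((pert_psd hB hx).kronecker (pert_psd hD hx))).smul (by norm_num : (0 : ℝ) ≤ 1 / 2)).1
    exact ((((continuousOn_const.mul (hω hσ0 hσ1 hτ0 hτ1)).add
      (continuousOn_const.mul (hω hσ0 hσ1 hτ1 hτ0))).sub
      (continuousOn_const.mul (hv hσ0))).sub (continuousOn_const.mul (hv hσ1))).sub hvs

lemma phi_one : phi 1 = Real.log 2 := by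
  unfold phi; norm_num; ring

lemma info_le {τ₀ τ₁ U : Matrix κ κ ℂ} {e : κ → ℝ}
    (hτ0 : τ₀.PosSemidef) (hτ1 : τ₁.PosSemidef) (tτ0 : τ₀.trace = 1) (tτ1 : τ₁.trace = 1)
    (hU : Uᴴ * U = 1) (hU' : U * Uᴴ = 1) (he : (1 / 2 : ℝ) • (τ₀ - τ₁) = U * rdiag e * Uᴴ) :
    vN ((1 / 2 : ℝ) • (τ₀ + τ₁)) - (1 / 2) * vN τ₀ - (1 / 2) * vN τ₁ ≤
      (∑ i, |e i|) * Real.log 2 := by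
  have := nonempty_of_trace tτ0
  have hse : ∑ i, e i = 0 := by
    have : (U * rdiag e * Uᴴ).trace = 0 := by
      rw [← he, trace_smul, trace_sub, tτ0, tτ1]; simp
    rw [trace_mul_comm, ← Matrix.mul_assoc, hU, Matrix.one_mul, rdiag, trace_diagonal,
      ← Complex.ofReal_sum] at this
    exact_mod_cast this
  have a1 : ∀ x : ℝ, (1 / 2 : ℝ) • (pert x τ₀ + pert x τ₁) + (1 / 2 : ℝ) • (pert x τ₀ - pert x τ₁) =
    pert x τ₀ := fun x => by module
  have a2 : ∀ x : ℝ, (1 / 2 : ℝ) • (pert x τ₀ + pert x τ₁) - (1 / 2 : ℝ) • (pert x τ₀ - pert x τ₁) =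
    pert x τ₁ := fun x => by module
  have psd : ∀ x ∈ Icc (0 : ℝ) 1, ((1 / 2 : ℝ) • (pert x τ₀ + pert x τ₁)).PosSemidef := fun x hx =>
    ((pert_psd hτ0 hx).add (pert_psd hτ1 hx)).smul (by norm_num : (0 : ℝ) ≤ 1 / 2)
  have hdh : ∀ x ∈ Icc (0 : ℝ) 1, ((1 / 2 : ℝ) • (pert x τ₀ - pert x τ₁)).IsHermitian := fun x hx => by
    have h := (pert_psd hτ0 hx).1.sub (pert_psd hτ1 hx).1
    unfold IsHermitian
    rw [conjTranspose_smul, h.eq]; simp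
  have hsm : ∀ (c : ℝ) {A : Matrix κ κ ℂ}, A.IsHermitian → (c • A).IsHermitian := by
    intro c A hA
    unfold IsHermitian
    rw [conjTranspose_smul, hA.eq]; simp
  have key : ∀ x ∈ Ioc (0 : ℝ) 1, _ := fun x hx =>
    partB (M := (1 / 2 : ℝ) • (pert x τ₀ + pert x τ₁)) (c := 1 - x)
      (psd x ⟨hx.1.le, hx.2⟩).1 (by rw [a1]; exact pert_pd hτ0 hx)
      (by rw [a2]; exact pert_pd hτ1 hx) hU (pert_diff he x) (by rw [← Finset.mul_sum, hse, mul_zero])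
      (by linarith [hx.2]) (by linarith [hx.1])
  have c1 : Continuous fun x => (1 / 2 : ℝ) • (pert x τ₀ + pert x τ₁) := by
    have u1 := pert_cont τ₀
    have u2 := pert_cont τ₁
    fun_prop
  have c2 : Continuous fun x : ℝ => (1 - x) • (1 / 2 : ℝ) • (pert x τ₀ - pert x τ₁) := by
    have u1 := pert_cont τ₀
    have u2 := pert_cont τ₁
    fun_prop
  have h := limit_le ?_ ?_ key
  · simp only [pert_zero, sub_zero, one_mul, one_smul, phi_one] at h
    have b1 := a1 0
    have b2 := a2 0
    simp only [pert_zero] at b1 b2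
    rw [b1, b2] at h
    linarith
  · have hp := phi_cont
    have : ContinuousOn (fun x => vN ((1 / 2 : ℝ) • (pert x τ₀ + pert x τ₁))) (Icc 0 1) :=
      vN_contOn c1.continuousOn fun x hx => (psd x hx).1
    refine (continuousOn_const.mul this).sub ?_
    fun_prop
  · refine ContinuousOn.add ?_ ?_
    · exact vN_contOn (c1.add c2).continuousOn fun x hx =>
        (psd x hx).1.add (hsm _ (hdh x hx))
    · exact vN_contOn (c1.sub c2).continuousOn fun x hx =>
        (psd x hx).1.sub (hsm _ (hdh x hx))

end limits

section scalar
open Set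

lemma log_conc {u v a b : ℝ} (hu : 0 < u) (hv : 0 < v) (ha : 0 ≤ a) (hb : 0 ≤ b) (hab : a + b = 1) :
    a * Real.log u + b * Real.log v ≤ Real.log (a * u + b * v) := by
  have h := strictConcaveOn_log_Ioi.concaveOn.2 (mem_Ioi.2 hu) (mem_Ioi.2 hv) ha hb hab
  simpa only [smul_eq_mul] using h

lemma cos_half_diff {a b : ℝ} (ha : a ∈ Icc (-1 : ℝ) 1) (hb : b ∈ Icc (-1 : ℝ) 1) :
    Real.cos ((1 / 2 : ℝ) * Real.arccos a - (1 / 2 : ℝ) * Real.arccos b) =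
      √((1 + a) / 2) * √((1 + b) / 2) + √((1 - a) / 2) * √((1 - b) / 2) := by
  have hc : ∀ {a : ℝ}, a ∈ Icc (-1 : ℝ) 1 →
      Real.cos ((1 / 2 : ℝ) * Real.arccos a) = √((1 + a) / 2) := fun {a} h => by
    rw [one_div, inv_mul_eq_div, Real.cos_half (by linarith [Real.arccos_nonneg a, Real.pi_pos])
      (Real.arccos_le_pi a), Real.cos_arccos h.1 h.2]
  have hs : ∀ {a : ℝ}, a ∈ Icc (-1 : ℝ) 1 →
      Real.sin ((1 / 2 : ℝ) * Real.arccos a) = √((1 - a) / 2) := fun {a} h => by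
    rw [one_div, inv_mul_eq_div, Real.sin_half_eq_sqrt (Real.arccos_nonneg a)
      (by linarith [Real.arccos_le_pi a, Real.pi_pos]), Real.cos_arccos h.1 h.2]
  rw [Real.cos_sub, hc ha, hc hb, hs ha, hs hb]

lemma half_sqrt {A C : ℝ} (hA : 0 < A) (hC : 0 < C) :
    √(C / 2) * √(A / 2) = (A / 2) * √(C / A) := by
  rw [← Real.sqrt_mul (by positivity)]
  rw [show C / 2 * (A / 2) = (A / 2) ^ 2 * (C / A) by field_simp,
    Real.sqrt_mul (by positivity), Real.sqrt_sq (by positivity)]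

lemma scalar_bound {x t : ℝ} (hx : x ∈ Icc (0 : ℝ) 1) (ht : t ∈ Icc (0 : ℝ) 1) :
    -2 * Real.log (Real.cos ((1 / 2 : ℝ) * Real.arccos (x * t) - (1 / 2 : ℝ) * Real.arccos t)) ≤
      (1 - x) * phi t := by
  obtain ⟨hx0, hx1⟩ := hx
  obtain ⟨ht0, ht1⟩ := ht
  have hxt : 0 ≤ x * t := mul_nonneg hx0 ht0
  have hxt' : x * t ≤ t := by nlinarith
  rw [cos_half_diff ⟨by linarith, by linarith⟩ ⟨by linarith, by linarith⟩]
  rcases ht1.lt_or_eq with h1 | rfl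
  · have hA : 0 < 1 + t := by linarith
    have hB : 0 < 1 - t := by linarith
    have hC : 0 < 1 + x * t := by linarith
    have hD : 0 < 1 - x * t := by linarith
    rw [half_sqrt hA hC, half_sqrt hB hD]
    have h := log_conc (Real.sqrt_pos.2 (div_pos hC hA)) (Real.sqrt_pos.2 (div_pos hD hB))
      (a := (1 + t) / 2) (b := (1 - t) / 2) (by positivity) (by positivity) (by ring)
    rw [Real.log_sqrt (by positivity), Real.log_sqrt (by positivity),
      Real.log_div hC.ne' hA.ne', Real.log_div hD.ne' hB.ne'] at h
    have k1 := log_conc hA one_pos hx0 (sub_nonneg.2 hx1) (by ring)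
    have k2 := log_conc hB one_pos hx0 (sub_nonneg.2 hx1) (by ring)
    rw [Real.log_one, mul_zero, add_zero] at k1 k2
    rw [show x * (1 + t) + (1 - x) * 1 = 1 + x * t by ring] at k1
    rw [show x * (1 - t) + (1 - x) * 1 = 1 - x * t by ring] at k2
    have m1 := mul_le_mul_of_nonneg_left k1 hA.le
    have m2 := mul_le_mul_of_nonneg_left k2 hB.le
    unfold phi
    nlinarith
  · have k1 := log_conc (u := 2) two_pos one_pos hx0 (sub_nonneg.2 hx1) (by ring)
    rw [Real.log_one, mul_zero, add_zero, show x * 2 + (1 - x) * 1 = 1 + x by ring] at k1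
    rw [phi_one]
    norm_num
    rw [← Real.sqrt_div' _ (by norm_num), Real.log_sqrt (by positivity),
      Real.log_div (by linarith) (by norm_num)]
    linarith

lemma h2_phi (p : ℝ) (hp : p ∈ Icc (0 : ℝ) (1 / 2)) : Real.log 2 - h2 p = phi (1 - 2 * p) := by
  unfold h2 phi
  rw [show 1 + (1 - 2 * p) = 2 * (1 - p) by ring, show 1 - (1 - 2 * p) = 2 * p by ring,
    Real.log_mul (by norm_num) (by linarith [hp.2])]
  rcases hp.1.lt_or_eq with h | rfl
  · rw [Real.log_mul (by norm_num) h.ne']; ring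
  · simp

lemma phi_pos {c : ℝ} (h : c ∈ Ioc (0 : ℝ) 1) : 0 < phi c := by
  have h1 := Real.strictConvexOn_mul_log.2 (x := 1 + c) (mem_Ici.2 (by linarith [h.1]))
    (y := 1 - c) (mem_Ici.2 (by linarith [h.2])) (by linarith [h.1])
    (show (0 : ℝ) < 1 / 2 by norm_num) (show (0 : ℝ) < 1 / 2 by norm_num) (by norm_num)
  simp only [smul_eq_mul] at h1
  rw [show 1 / 2 * (1 + c) + 1 / 2 * (1 - c) = 1 by ring, Real.log_one] at h1
  unfold phi
  linarith

lemma phi_lt {a b : ℝ} (ha : 0 ≤ a) (hab : a < b) (hb : b ≤ 1) : phi a < phi b := by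
  have hbp : 0 < b := ha.trans_lt hab
  have h := phi_convex.2 (show (0 : ℝ) ∈ Icc (-1 : ℝ) 1 from ⟨by norm_num, by norm_num⟩)
    (show b ∈ Icc (-1 : ℝ) 1 from ⟨by linarith, hb⟩)
    (show 0 ≤ 1 - a / b by rw [sub_nonneg, div_le_one hbp]; exact hab.le)
    (show 0 ≤ a / b by positivity) (by ring)
  simp only [smul_eq_mul, mul_zero, phi_zero, zero_add] at h
  rw [div_mul_cancel₀ _ hbp.ne'] at h
  have : a / b < 1 := by rwa [div_lt_one hbp]
  nlinarith [phi_pos ⟨hbp, hb⟩]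

end scalar

section boundd
open Set
variable {ι κ : Type} [Fintype ι] [DecidableEq ι] [Fintype κ] [DecidableEq κ]

lemma diff_spec {σ₀ σ₁ : Matrix ι ι ℂ} (hσ0 : σ₀.PosSemidef) (hσ1 : σ₁.PosSemidef)
    (tσ0 : σ₀.trace = 1) (tσ1 : σ₁.trace = 1) :
    ∃ (W : Matrix ι ι ℂ) (a : ι → ℝ), Wᴴ * W = 1 ∧ W * Wᴴ = 1 ∧
      (1 / 2 : ℝ) • (σ₀ - σ₁) = W * rdiag a * Wᴴ ∧ ∑ i, |a i| ≤ 1 := by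
  have hh : ((1 / 2 : ℝ) • (σ₀ - σ₁)).IsHermitian := by
    have h := hσ0.1.sub hσ1.1
    unfold IsHermitian
    rw [conjTranspose_smul, h.eq]; simp
  obtain ⟨W, a, h1, h2, h3, -⟩ := spec_exists hh
  refine ⟨W, a, h1, h2, h3, ?_⟩
  have e1 : (1 / 2 : ℝ) • (σ₀ + σ₁) + (1 / 2 : ℝ) • (σ₀ - σ₁) = σ₀ := by module
  have e2 : (1 / 2 : ℝ) • (σ₀ + σ₁) - (1 / 2 : ℝ) • (σ₀ - σ₁) = σ₁ := by module
  refine T_le_one (M := (1 / 2 : ℝ) • (σ₀ + σ₁)) (by rw [e1]; exact hσ0)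
    (by rw [e2]; exact hσ1) h1 h2 h3 ?_
  rw [trace_smul, trace_add, tσ0, tσ1, Complex.real_smul]
  norm_num

lemma info_ge {σ₀ σ₁ W : Matrix ι ι ℂ} {a : ι → ℝ}
    (hσ0 : σ₀.PosSemidef) (hσ1 : σ₁.PosSemidef) (tσ0 : σ₀.trace = 1) (tσ1 : σ₁.trace = 1)
    (hW : Wᴴ * W = 1) (hW' : W * Wᴴ = 1) (ha : (1 / 2 : ℝ) • (σ₀ - σ₁) = W * rdiag a * Wᴴ) :
    phi (∑ i, |a i|) ≤ vN ((1 / 2 : ℝ) • (σ₀ + σ₁)) - (1 / 2) * vN σ₀ - (1 / 2) * vN σ₁ := by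
  have hz : (rdiag (fun _ : Unit => (0 : ℝ))) = 0 := by
    ext i j; simp [rdiag]
  have t1 : (1 : Matrix Unit Unit ℂ).trace = 1 := by simp [trace_one]
  have h := core_psd hσ0 hσ1 (PosSemidef.one (n := Unit) (R := ℂ)) PosSemidef.one tσ0 tσ1 t1 t1
    hW hW' ha
    (U := 1) (e := fun _ => 0) (by simp) (by simp) (by rw [hz]; simp)
  have e1 : (1 / 2 : ℝ) • (σ₀ ⊗ₖ (1 : Matrix Unit Unit ℂ) + σ₁ ⊗ₖ (1 : Matrix Unit Unit ℂ)) =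
      ((1 / 2 : ℝ) • (σ₀ + σ₁)) ⊗ₖ (1 : Matrix Unit Unit ℂ) := by
    rw [smul_kronecker, add_kronecker]
  have e2 : (1 / 2 : ℝ) • ((1 : Matrix Unit Unit ℂ) + 1) = 1 := by module
  have hp : ((1 / 2 : ℝ) • (σ₀ + σ₁)).PosSemidef :=
    (hσ0.add hσ1).smul (by norm_num : (0 : ℝ) ≤ 1 / 2)
  have ht : ((1 / 2 : ℝ) • (σ₀ + σ₁)).trace = 1 := by
    rw [trace_smul, trace_add, tσ0, tσ1, Complex.real_smul]
    norm_num
  rw [e1, e2, vN_kron hp.1 (isHermitian_one), ht, t1] at h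
  simp only [abs_zero, Finset.sum_const_zero, sub_zero, one_mul, Complex.one_re] at h
  linarith

lemma bound_d {σ₀ σ₁ : Matrix ι ι ℂ} {τ₀ τ₁ : Matrix κ κ ℂ}
    (hσ0 : σ₀.PosSemidef) (hσ1 : σ₁.PosSemidef) (hτ0 : τ₀.PosSemidef) (hτ1 : τ₁.PosSemidef)
    (tσ0 : σ₀.trace = 1) (tσ1 : σ₁.trace = 1) (tτ0 : τ₀.trace = 1) (tτ1 : τ₁.trace = 1)
    {H₁ p : ℝ}
    (hH₁ : H₁ = Real.log 2 + (1 / 2 : ℝ) * vN σ₀ + (1 / 2 : ℝ) * vN σ₁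
        - vN ((1 / 2 : ℝ) • (σ₀ + σ₁)))
    (hp : p ∈ Icc (0 : ℝ) (1 / 2))
    (hhp : h2 p = Real.log 2 + (1 / 2 : ℝ) * vN τ₀ + (1 / 2 : ℝ) * vN τ₁
        - vN ((1 / 2 : ℝ) • (τ₀ + τ₁))) :
    -2 * Real.log (Real.cos
          ((1 / 2 : ℝ) * Real.arccos ((1 - 2 * p) * (2 * Real.exp (-H₁) - 1))
            - (1 / 2 : ℝ) * Real.arccos (2 * Real.exp (-H₁) - 1))) ≤
      (1 / 2) * vN ((1 / 2 : ℝ) • (σ₀ ⊗ₖ τ₀ + σ₁ ⊗ₖ τ₁)) +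
      (1 / 2) * vN ((1 / 2 : ℝ) • (σ₀ ⊗ₖ τ₁ + σ₁ ⊗ₖ τ₀)) -
      (1 / 2) * vN σ₀ - (1 / 2) * vN σ₁ - vN ((1 / 2 : ℝ) • (τ₀ + τ₁)) := by
  obtain ⟨W, a, hW, hW', ha, hT1⟩ := diff_spec hσ0 hσ1 tσ0 tσ1
  obtain ⟨U, e, hU, hU', he, hT2⟩ := diff_spec hτ0 hτ1 tτ0 tτ1
  have core := core_psd hσ0 hσ1 hτ0 hτ1 tσ0 tσ1 tτ0 tτ1 hW hW' ha hU hU' he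
  have i1 := info_ge hσ0 hσ1 tσ0 tσ1 hW hW' ha
  have i2 := info_ge hτ0 hτ1 tτ0 tτ1 hU hU' he
  have i3 := info_le hσ0 hσ1 tσ0 tσ1 hW hW' ha
  have n1 : 0 ≤ ∑ i, |a i| := Finset.sum_nonneg fun i _ => abs_nonneg _
  have n2 : 0 ≤ ∑ i, |e i| := Finset.sum_nonneg fun i _ => abs_nonneg _
  set T1 := ∑ i, |a i|
  set T2 := ∑ i, |e i|
  have hx : (1 - 2 * p) ∈ Icc (0 : ℝ) 1 := ⟨by linarith [hp.2], by linarith [hp.1]⟩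
  have hT2x : T2 ≤ 1 - 2 * p := by
    by_contra hn
    have := phi_lt hx.1 (not_le.1 hn) hT2
    have := h2_phi p hp
    linarith
  have hI0 : 0 ≤ Real.log 2 - H₁ := by
    have := phi_nonneg (c := T1) ⟨by linarith, hT1⟩
    linarith
  have hexp : 2 * Real.exp (-H₁) = Real.exp (Real.log 2 - H₁) := by
    rw [sub_eq_add_neg, Real.exp_add, Real.exp_log two_pos]
  have ht0 : 0 ≤ 2 * Real.exp (-H₁) - 1 := by
    rw [hexp]; linarith [Real.one_le_exp hI0]
  have htT : 2 * Real.exp (-H₁) - 1 ≤ T1 := by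
    have k := log_conc (u := 2) two_pos one_pos n1 (sub_nonneg.2 hT1) (by ring)
    rw [Real.log_one, mul_zero, add_zero, show T1 * 2 + (1 - T1) * 1 = 1 + T1 by ring] at k
    have : Real.exp (Real.log 2 - H₁) ≤ 1 + T1 := by
      rw [← Real.le_log_iff_exp_le (by linarith)]
      linarith
    rw [hexp]; linarith
  have hs := scalar_bound hx ⟨ht0, htT.trans hT1⟩
  have hm := phi_mono ht0 htT hT1
  have hpn := phi_nonneg (c := T1) ⟨by linarith, hT1⟩
  calc _ ≤ _ := hs
    _ ≤ (1 - (1 - 2 * p)) * phi T1 := mul_le_mul_of_nonneg_left hm (by linarith [hx.2])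
    _ ≤ (1 - T2) * phi T1 := mul_le_mul_of_nonneg_right (by linarith) hpn
    _ ≤ _ := core

end boundd

section duality
open Set
variable {ι κ : Type} [Fintype ι] [DecidableEq ι] [Fintype κ] [DecidableEq κ]

lemma psd_factor {A : Matrix ι ι ℂ} (h : A.PosSemidef) : ∃ K : Matrix ι ι ℂ, Kᴴ * K = A := by
  obtain ⟨U, a, hU, hU', hd, -, hv, hae⟩ := spec_exists h.1
  have h0 : ∀ i, 0 ≤ a i := fun i => by rw [hae]; exact h.eigenvalues_nonneg i
  refine ⟨rdiag (fun i => √(a i)) * Uᴴ, ?_⟩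
  have hh : (rdiag (fun i => √(a i)))ᴴ = rdiag (fun i => √(a i)) := rdiag_herm _
  have hsq : rdiag (fun i => √(a i)) * rdiag (fun i => √(a i)) = rdiag a := by
    unfold rdiag
    rw [diagonal_mul_diagonal]
    congr 1
    ext i
    rw [← Complex.ofReal_mul, Real.mul_self_sqrt (h0 i)]
  rw [conjTranspose_mul, conjTranspose_conjTranspose, hh]
  conv_rhs => rw [hd, ← hsq]
  simp only [Matrix.mul_assoc]

lemma dual_exists {σ₀ σ₁ : Matrix ι ι ℂ} (hσ0 : σ₀.PosSemidef) (hσ1 : σ₁.PosSemidef) :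
    ∃ V₀ V₁ : Matrix (ι ⊕ ι) ι ℂ, V₀ᴴ * V₀ = (1 / 2 : ℝ) • (σ₀ + σ₁) ∧
      V₁ᴴ * V₁ = (1 / 2 : ℝ) • (σ₀ + σ₁) ∧ V₀ᴴ * V₁ = (1 / 2 : ℝ) • (σ₀ - σ₁) ∧
      V₁ᴴ * V₀ = (1 / 2 : ℝ) • (σ₀ - σ₁) := by
  obtain ⟨K, hK⟩ := psd_factor (hσ0.smul (by norm_num : (0 : ℝ) ≤ 1 / 2))
  obtain ⟨L, hL⟩ := psd_factor (hσ1.smul (by norm_num : (0 : ℝ) ≤ 1 / 2))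
  refine ⟨fromRows K L, fromRows K (-L), ?_, ?_, ?_, ?_⟩ <;>
  · rw [conjTranspose_fromRows_eq_fromCols_conjTranspose, fromCols_mul_fromRows]
    simp only [conjTranspose_neg, Matrix.neg_mul, Matrix.mul_neg, neg_neg, hK, hL]
    module

lemma vN_half {A : Matrix ι ι ℂ} (hA : A.IsHermitian) (ht : A.trace = 1) :
    vN ((1 / 2 : ℝ) • A) = (1 / 2) * vN A + (1 / 2) * Real.log 2 := by
  rw [vN_smul hA, ht, Complex.one_re, Real.negMulLog, one_div, Real.log_inv]
  ring

lemma trace_half {A B : Matrix ι ι ℂ} (hA : A.trace = 1) (hB : B.trace = 1) :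
    ((1 / 2 : ℝ) • (A + B)).trace = 1 := by
  rw [trace_smul, trace_add, hA, hB, Complex.real_smul]
  norm_num

lemma psd_half {A B : Matrix ι ι ℂ} (hA : A.PosSemidef) (hB : B.PosSemidef) :
    ((1 / 2 : ℝ) • (A + B)).PosSemidef :=
  (hA.add hB).smul (by norm_num : (0 : ℝ) ≤ 1 / 2)

lemma trace_kron_one {A : Matrix ι ι ℂ} {B : Matrix κ κ ℂ} (hA : A.trace = 1)
    (hB : B.trace = 1) : (A ⊗ₖ B).trace = 1 := by
  rw [trace_kronecker, hA, hB, mul_one]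

lemma vN_gram (V : Matrix κ ι ℂ) : vN (V * Vᴴ) = vN (Vᴴ * V) :=
  vN_mul_comm V Vᴴ (posSemidef_self_mul_conjTranspose V).1 (posSemidef_conjTranspose_mul_self V).1

lemma kron_gram {α β γ δ : Type} [Fintype α] [Fintype γ] (A B : Matrix α β ℂ) (C D : Matrix γ δ ℂ) :
    (A ⊗ₖ C)ᴴ * (B ⊗ₖ D) = (Aᴴ * B) ⊗ₖ (Cᴴ * D) := by
  rw [conjTranspose_kronecker, ← mul_kronecker_mul]

lemma kron_gram' {α β γ δ : Type} [Fintype β] [Fintype δ] (A : Matrix α β ℂ) (C : Matrix γ δ ℂ) :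
    (A ⊗ₖ C) * (A ⊗ₖ C)ᴴ = (A * Aᴴ) ⊗ₖ (C * Cᴴ) := by
  rw [conjTranspose_kronecker, ← mul_kronecker_mul]

lemma bound_b {σ₀ σ₁ : Matrix ι ι ℂ} {τ₀ τ₁ : Matrix κ κ ℂ}
    (hσ0 : σ₀.PosSemidef) (hσ1 : σ₁.PosSemidef) (hτ0 : τ₀.PosSemidef) (hτ1 : τ₁.PosSemidef)
    (tσ0 : σ₀.trace = 1) (tσ1 : σ₁.trace = 1) (tτ0 : τ₀.trace = 1) (tτ1 : τ₁.trace = 1)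
    {H₁ q : ℝ}
    (hH₁ : H₁ = Real.log 2 + (1 / 2 : ℝ) * vN σ₀ + (1 / 2 : ℝ) * vN σ₁
        - vN ((1 / 2 : ℝ) • (σ₀ + σ₁)))
    (hq : q ∈ Icc (0 : ℝ) (1 / 2))
    (hhq : h2 q = Real.log 2 - (Real.log 2 + (1 / 2 : ℝ) * vN τ₀ + (1 / 2 : ℝ) * vN τ₁
        - vN ((1 / 2 : ℝ) • (τ₀ + τ₁)))) :
    -2 * Real.log (Real.cos
          ((1 / 2 : ℝ) * Real.arccos ((1 - 2 * q) * (Real.exp H₁ - 1))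
            - (1 / 2 : ℝ) * Real.arccos (Real.exp H₁ - 1))) ≤
      (1 / 2) * vN ((1 / 2 : ℝ) • (σ₀ ⊗ₖ τ₀ + σ₁ ⊗ₖ τ₁)) +
      (1 / 2) * vN ((1 / 2 : ℝ) • (σ₀ ⊗ₖ τ₁ + σ₁ ⊗ₖ τ₀)) -
      (1 / 2) * vN τ₀ - (1 / 2) * vN τ₁ - vN ((1 / 2 : ℝ) • (σ₀ + σ₁)) := by
  obtain ⟨V, W, v1, v2, v3, v4⟩ := dual_exists hσ0 hσ1
  obtain ⟨X, Y, x1, x2, x3, x4⟩ := dual_exists hτ0 hτ1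
  have tg : ∀ {α β : Type} [Fintype α] [Fintype β] (A : Matrix α β ℂ), (Aᴴ * A).trace = 1 →
      (A * Aᴴ).trace = 1 := fun A h => by rw [trace_mul_comm]; exact h
  have tsum : ∀ {α : Type} [Fintype α] [DecidableEq α] {A B : Matrix α α ℂ},
      (1 / 2 : ℝ) • (A + B) + (1 / 2 : ℝ) • (A - B) = A := fun {α} _ _ {A B} => by module
  have tdiff : ∀ {α : Type} [Fintype α] [DecidableEq α] {A B : Matrix α α ℂ},
      (1 / 2 : ℝ) • (A + B) - (1 / 2 : ℝ) • (A - B) = B := fun {α} _ _ {A B} => by module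
  have dσ := vN_dual V W _ _ v1 v2 v3 v4
  have dτ := vN_dual X Y _ _ x1 x2 x3 x4
  rw [tsum, tdiff, vN_half hσ0.1 tσ0, vN_half hσ1.1 tσ1] at dσ
  rw [tsum, tdiff, vN_half hτ0.1 tτ0, vN_half hτ1.1 tτ1] at dτ
  set S := ((1 / 2 : ℝ) • (σ₀ + σ₁)) ⊗ₖ ((1 / 2 : ℝ) • (τ₀ + τ₁)) with hS
  set D := ((1 / 2 : ℝ) • (σ₀ - σ₁)) ⊗ₖ ((1 / 2 : ℝ) • (τ₀ - τ₁)) with hD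
  have eS : S + D = (1 / 2 : ℝ) • (σ₀ ⊗ₖ τ₀ + σ₁ ⊗ₖ τ₁) := by
    ext ⟨i, k⟩ ⟨j, l⟩
    simp only [hS, hD, Matrix.add_apply, Matrix.sub_apply, Matrix.smul_apply, kroneckerMap_apply,
      Complex.real_smul]
    push_cast
    ring
  have eD : S - D = (1 / 2 : ℝ) • (σ₀ ⊗ₖ τ₁ + σ₁ ⊗ₖ τ₀) := by
    ext ⟨i, k⟩ ⟨j, l⟩
    simp only [hS, hD, Matrix.add_apply, Matrix.sub_apply, Matrix.smul_apply, kroneckerMap_apply,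
      Complex.real_smul]
    push_cast
    ring
  have w0 := vN_dual (V ⊗ₖ X) (W ⊗ₖ Y) S D (by rw [kron_gram, v1, x1]) (by rw [kron_gram, v2, x2])
    (by rw [kron_gram, v3, x3]) (by rw [kron_gram, v4, x4])
  have w1 := vN_dual (V ⊗ₖ Y) (W ⊗ₖ X) S D (by rw [kron_gram, v1, x2]) (by rw [kron_gram, v2, x1])
    (by rw [kron_gram, v3, x4]) (by rw [kron_gram, v4, x3])
  have vh : ∀ {A B : Matrix ι ι ℂ} {C E : Matrix κ κ ℂ}, A.PosSemidef → B.PosSemidef →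
      C.PosSemidef → E.PosSemidef → A.trace = 1 → B.trace = 1 → C.trace = 1 → E.trace = 1 →
      vN ((1 / 2 : ℝ) • ((1 / 2 : ℝ) • (A ⊗ₖ C + B ⊗ₖ E))) =
        (1 / 2) * vN ((1 / 2 : ℝ) • (A ⊗ₖ C + B ⊗ₖ E)) + (1 / 2) * Real.log 2 := by
    intro A B C E hA hB hC hE tA tB tC tE
    exact vN_half (psd_half (hA.kronecker hC) (hB.kronecker hE)).1
      (trace_half (trace_kron_one tA tC) (trace_kron_one tB tE))
  rw [kron_gram', kron_gram', eS, eD, vh hσ0 hσ1 hτ0 hτ1 tσ0 tσ1 tτ0 tτ1,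
    vh hσ0 hσ1 hτ1 hτ0 tσ0 tσ1 tτ1 tτ0] at w0 w1
  have gV := vN_gram V
  have gW := vN_gram W
  have gX := vN_gram X
  have gY := vN_gram Y
  rw [v1] at gV
  rw [v2] at gW
  rw [x1] at gX
  rw [x2] at gY
  have hb := bound_d (posSemidef_self_mul_conjTranspose V) (posSemidef_self_mul_conjTranspose W)
    (posSemidef_self_mul_conjTranspose X) (posSemidef_self_mul_conjTranspose Y)
    (tg V (by rw [v1]; exact trace_half tσ0 tσ1)) (tg W (by rw [v2]; exact trace_half tσ0 tσ1))
    (tg X (by rw [x1]; exact trace_half tτ0 tτ1)) (tg Y (by rw [x2]; exact trace_half tτ0 tτ1))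
    (H₁ := Real.log 2 - H₁) (p := q) (by rw [dσ, gV, gW]; linarith) hq
    (by rw [dτ, gX, gY]; linarith)
  have hexp : 2 * Real.exp (-(Real.log 2 - H₁)) = Real.exp H₁ := by
    rw [neg_sub, Real.exp_sub, Real.exp_log two_pos]; ring
  rw [hexp, dτ, gV, gW, w0, w1] at hb
  linarith

lemma vN_swap {A B : Matrix ι ι ℂ} {C D : Matrix κ κ ℂ} (hA : A.PosSemidef) (hB : B.PosSemidef)
    (hC : C.PosSemidef) (hD : D.PosSemidef) :
    vN ((1 / 2 : ℝ) • (C ⊗ₖ A + D ⊗ₖ B)) = vN ((1 / 2 : ℝ) • (A ⊗ₖ C + B ⊗ₖ D)) := by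
  rw [← vN_reindex (Equiv.prodComm ι κ) (psd_half (hA.kronecker hC) (hB.kronecker hD)).1]
  congr 1
  ext ⟨i, k⟩ ⟨j, l⟩
  simp [mul_comm]

end duality

/-- **Mrs. Gerber's Lemma with quantum side information (two different channels).**
With `H₁ = H(X₁|B₁)`, `H₂ = H(X₂|B₂)`, `G = H(X₁+X₂|B₁B₂)` and
`p₁, p₂, q₁, q₂ ∈ [0,1/2]` satisfying `h₂(p₁)=H₁`, `h₂(p₂)=H₂`, `h₂(q₁)=ln 2−H₁`,
`h₂(q₂)=ln 2−H₂`, the conditional entropy `G` is at least the maximum of the four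
stated expressions. -/
theorem mrs_gerber_quantum_two_channels (d₁ d₂ : ℕ)
    (σ₀ σ₁ : Matrix (Fin d₁) (Fin d₁) ℂ) (τ₀ τ₁ : Matrix (Fin d₂) (Fin d₂) ℂ)
    (hσ0 : σ₀.PosSemidef) (hσ0t : σ₀.trace = 1)
    (hσ1 : σ₁.PosSemidef) (hσ1t : σ₁.trace = 1)
    (hτ0 : τ₀.PosSemidef) (hτ0t : τ₀.trace = 1)
    (hτ1 : τ₁.PosSemidef) (hτ1t : τ₁.trace = 1)
    (H₁ H₂ G : ℝ)
    (hH₁ : H₁ = Real.log 2 + (1 / 2 : ℝ) * vN σ₀ + (1 / 2 : ℝ) * vN σ₁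
        - vN ((1 / 2 : ℝ) • (σ₀ + σ₁)))
    (hH₂ : H₂ = Real.log 2 + (1 / 2 : ℝ) * vN τ₀ + (1 / 2 : ℝ) * vN τ₁
        - vN ((1 / 2 : ℝ) • (τ₀ + τ₁)))
    (hG : G = Real.log 2
        + (1 / 2 : ℝ) * vN ((1 / 2 : ℝ) • (σ₀ ⊗ₖ τ₀ + σ₁ ⊗ₖ τ₁))
        + (1 / 2 : ℝ) * vN ((1 / 2 : ℝ) • (σ₀ ⊗ₖ τ₁ + σ₁ ⊗ₖ τ₀))
        - vN (((1 / 2 : ℝ) • (σ₀ + σ₁)) ⊗ₖ ((1 / 2 : ℝ) • (τ₀ + τ₁))))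
    (p₁ p₂ q₁ q₂ : ℝ)
    (hp₁ : p₁ ∈ Set.Icc (0 : ℝ) (1 / 2)) (hp₂ : p₂ ∈ Set.Icc (0 : ℝ) (1 / 2))
    (hq₁ : q₁ ∈ Set.Icc (0 : ℝ) (1 / 2)) (hq₂ : q₂ ∈ Set.Icc (0 : ℝ) (1 / 2))
    (hhp₁ : h2 p₁ = H₁) (hhp₂ : h2 p₂ = H₂)
    (hhq₁ : h2 q₁ = Real.log 2 - H₁) (hhq₂ : h2 q₂ = Real.log 2 - H₂) :
    G ≥ H₁ - 2 * Real.log (Real.cos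
          ((1 / 2 : ℝ) * Real.arccos ((1 - 2 * q₁) * (Real.exp H₂ - 1))
            - (1 / 2 : ℝ) * Real.arccos (Real.exp H₂ - 1)))
    ∧ G ≥ H₂ - 2 * Real.log (Real.cos
          ((1 / 2 : ℝ) * Real.arccos ((1 - 2 * q₂) * (Real.exp H₁ - 1))
            - (1 / 2 : ℝ) * Real.arccos (Real.exp H₁ - 1)))
    ∧ G ≥ H₂ - 2 * Real.log (Real.cos
          ((1 / 2 : ℝ) * Real.arccos ((1 - 2 * p₁) * (2 * Real.exp (-H₂) - 1))
            - (1 / 2 : ℝ) * Real.arccos (2 * Real.exp (-H₂) - 1)))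
    ∧ G ≥ H₁ - 2 * Real.log (Real.cos
          ((1 / 2 : ℝ) * Real.arccos ((1 - 2 * p₂) * (2 * Real.exp (-H₁) - 1))
            - (1 / 2 : ℝ) * Real.arccos (2 * Real.exp (-H₁) - 1))) := by
  rw [vN_kron (psd_half hσ0 hσ1).1 (psd_half hτ0 hτ1).1, trace_half hσ0t hσ1t,
    trace_half hτ0t hτ1t, Complex.one_re, one_mul, one_mul] at hG
  have s0 := vN_swap hσ0 hσ1 hτ0 hτ1
  have s1 : vN ((1 / 2 : ℝ) • (τ₀ ⊗ₖ σ₁ + τ₁ ⊗ₖ σ₀)) =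
      vN ((1 / 2 : ℝ) • (σ₀ ⊗ₖ τ₁ + σ₁ ⊗ₖ τ₀)) := by
    rw [add_comm, vN_swap hσ0 hσ1 hτ1 hτ0]
  have ba := bound_b hτ0 hτ1 hσ0 hσ1 hτ0t hτ1t hσ0t hσ1t hH₂ hq₁ (by rw [hhq₁, hH₁])
  have bb := bound_b hσ0 hσ1 hτ0 hτ1 hσ0t hσ1t hτ0t hτ1t hH₁ hq₂ (by rw [hhq₂, hH₂])
  have bc := bound_d hτ0 hτ1 hσ0 hσ1 hτ0t hτ1t hσ0t hσ1t hH₂ hp₁ (by rw [hhp₁, hH₁])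
  have bd := bound_d hσ0 hσ1 hτ0 hτ1 hσ0t hσ1t hτ0t hτ1t hH₁ hp₂ (by rw [hhp₂, hH₂])
  rw [s0, s1] at ba bc
  refine ⟨?_, ?_, ?_, ?_⟩ <;> linarith
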